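/- arXiv:2007.13660 — 6 statements merged into one kernel-verified Lean document; each statement's English description precedes it below -/
import Mathlib

section
/- Let k ≥ 2 be even, let s, m ≥ 1, and let ε, δ ≥ 0 with ε + δ ≤ 0.07. Let A be any (ε,δ)-differentially private mechanism (with respect to user-level adjacency) on datasets of s users, each user holding m samples from the alphabet [k] = {1,...,k}, whose output distribution depends on the dataset only through the total count vector N = (N_1,...,N_k), where N_i is the total number of occurrences of symbol i among all sm samples, and whose output p̂ lies in the probability simplex Δ_k. Then sup over p ∈ Δ_k of E[ℓ1(p, p̂)] ≥ 0.1 · min( k / (200 s (ε+δ)), 1 ), where the samples are drawn i.i.d. from p and the expectation is over the samples and the mechanism's randomness. -/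
open MeasureTheory ProbabilityTheory

/-- The measure on `Fin k` induced by a probability vector `p`. -/
noncomputable def discMeasure {k : ℕ} (p : Fin k → ℝ) : Measure (Fin k) :=
  ∑ i : Fin k, ENNReal.ofReal (p i) • Measure.dirac i

/-- The total count vector of a dataset of `s` users each holding `m` samples from `[k]`. -/
def countVec {k s m : ℕ} (D : Fin s → Fin m → Fin k) (i : Fin k) : ℕ :=
  (Finset.univ.filter fun uj : Fin s × Fin m => D uj.1 uj.2 = i).card

open scoped ENNReal

/-- For small `ε`, one step of `(ε, δ)`-indistinguishability bounds the additive gap by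
`2 (ε + δ)`. -/
lemma measure_le_add_of_dp {Θ : Type*} [MeasurableSpace Θ] {μ μ' : Measure Θ}
    [IsProbabilityMeasure μ'] {ε δ : ℝ} (hε : 0 ≤ ε) (hε' : ε ≤ 1 / 2) (hδ : 0 ≤ δ) {S : Set Θ}
    (h : μ S ≤ ENNReal.ofReal (Real.exp ε) * μ' S + ENNReal.ofReal δ) :
    μ S ≤ μ' S + ENNReal.ofReal (2 * (ε + δ)) := by
  have hexp : Real.exp ε ≤ 1 + 2 * ε := by
    refine (Real.exp_bound_div_one_sub_of_interval hε (by linarith)).trans ?_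
    rw [div_le_iff₀ (by linarith)]
    nlinarith
  calc μ S ≤ ENNReal.ofReal (Real.exp ε) * μ' S + ENNReal.ofReal δ := h
    _ ≤ ENNReal.ofReal (1 + 2 * ε) * μ' S + ENNReal.ofReal δ := by gcongr
    _ = μ' S + ENNReal.ofReal (2 * ε) * μ' S + ENNReal.ofReal δ := by
        rw [ENNReal.ofReal_add zero_le_one (by linarith), ENNReal.ofReal_one, add_mul, one_mul]
    _ ≤ μ' S + ENNReal.ofReal (2 * ε) * 1 + ENNReal.ofReal δ := by
        gcongr
        exact prob_le_one
    _ = μ' S + ENNReal.ofReal (2 * ε + δ) := by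
        rw [mul_one, add_assoc, ENNReal.ofReal_add (by linarith) hδ]
    _ ≤ μ' S + ENNReal.ofReal (2 * (ε + δ)) := by
        gcongr
        linarith

/-- A function that changes by at most `c` when one coordinate changes, changes by at most
`#A * c` when the coordinates in `A` change. -/
lemma le_add_card_mul_of_eq_off {ι β : Type*} [DecidableEq ι] {F : (ι → β) → ℝ≥0∞} {c : ℝ≥0∞}
    (hF : ∀ D D' : ι → β, (∃ u, ∀ v, v ≠ u → D v = D' v) → F D ≤ F D' + c) (A : Finset ι) :
    ∀ D D' : ι → β, (∀ v, v ∉ A → D v = D' v) → F D ≤ F D' + A.card * c := by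
  induction A using Finset.induction_on with
  | empty =>
    intro D D' h
    have : D = D' := funext fun v => h v (by simp)
    simp [this]
  | insert a A ha ih =>
    intro D D' h
    have hone : F D ≤ F (Function.update D a (D' a)) + c :=
      hF _ _ ⟨a, fun v hv => by simp [hv]⟩
    have hrest : F (Function.update D a (D' a)) ≤ F D' + A.card * c := by
      refine ih _ _ fun v hv => ?_
      by_cases hva : v = a
      · subst hva; simp
      · simpa [hva] using h v (by simp [hva, hv])
    calc F D ≤ F (Function.update D a (D' a)) + c := hone
      _ ≤ F D' + A.card * c + c := by gcongr
      _ = F D' + (insert a A).card * c := by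
        rw [Finset.card_insert_of_notMem ha]; push_cast; ring

/-- If moreover the function is invariant under permuting all samples, then changing the samples
in a set of size at most `h * m` costs no more than changing `h` users. -/
lemma le_add_mul_of_perm_invariant {s m : ℕ} {β : Type*} {F : (Fin s → Fin m → β) → ℝ≥0∞}
    {c : ℝ≥0∞} (hF : ∀ D D', (∃ u, ∀ v, v ≠ u → D v = D' v) → F D ≤ F D' + c)
    (hperm : ∀ (σ : Equiv.Perm (Fin s × Fin m)) (D : Fin s → Fin m → β),
      F (fun u j => D (σ (u, j)).1 (σ (u, j)).2) = F D)
    (T : Finset (Fin s × Fin m)) (h : ℕ) (hT : T.card ≤ h * m) (D D' : Fin s → Fin m → β)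
    (hDD' : ∀ x, x ∉ T → D x.1 x.2 = D' x.1 x.2) : F D ≤ F D' + h * c := by
  obtain ⟨A, -, hA⟩ := Finset.exists_subset_card_eq
    (s := (Finset.univ : Finset (Fin s))) (n := min h s) (by simp)
  have hTU : T.card ≤ (A ×ˢ (Finset.univ : Finset (Fin m))).card := by
    rw [Finset.card_product, hA, Finset.card_univ, Fintype.card_fin]
    rcases le_total h s with hhs | hhs
    · simpa [hhs] using hT
    · simpa [hhs] using T.card_le_univ
  obtain ⟨T', hT'U, hT'⟩ := Finset.exists_subset_card_eq hTU
  let σ : Equiv.Perm (Fin s × Fin m) := (Finset.equivOfCardEq hT').extendSubtype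
  have hσ : ∀ x, x ∉ T' → σ x ∉ T := fun x hx => Equiv.extendSubtype_not_mem _ x hx
  rw [← hperm σ D, ← hperm σ D']
  refine (le_add_card_mul_of_eq_off hF A _
    (fun u j => D' (σ (u, j)).1 (σ (u, j)).2) fun v hv => ?_).trans ?_
  · funext j
    refine hDD' _ (hσ _ fun hmem => hv ?_)
    exact (Finset.mem_product.1 (hT'U hmem)).1
  · rw [hA]
    gcongr
    exact min_le_left _ _

lemma countVec_perm {k s m : ℕ} (σ : Equiv.Perm (Fin s × Fin m)) (D : Fin s → Fin m → Fin k) :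
    countVec (fun u j => D (σ (u, j)).1 (σ (u, j)).2) = countVec D := by
  funext i
  unfold countVec
  refine Finset.card_bij (fun x _ => σ x) ?_ ?_ ?_
  · intro x hx
    simpa using hx
  · intro x _ y _ hxy
    exact σ.injective hxy
  · intro y hy
    exact ⟨σ.symm y, by simpa using hy, by simp⟩

/-- The source of randomness of the hard instances: a uniform index of a pair, a uniform sign and
an independent Bernoulli(`η`) bit telling whether the sign is to be overridden. -/
noncomputable def sourceMeasure (n : ℕ) (η : ℝ) : Measure (Fin n × Bool × Bool) :=
  ∑ i : Fin n, ∑ b : Bool,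
    (ENNReal.ofReal ((1 - η) / (2 * n)) • Measure.dirac (i, b, false) +
      ENNReal.ofReal (η / (2 * n)) • Measure.dirac (i, b, true))

/-- The symbol read off from the source when the overriding signs are `v`. -/
def readSymbol {n k : ℕ} (e : Fin n × Bool ≃ Fin k) (v : Fin n → Bool)
    (ω : Fin n × Bool × Bool) : Fin k :=
  e (ω.1, if ω.2.2 then v ω.1 else ω.2.1)

/-- The hard instance with signs `v`: symbol `(i, v i)` gets mass `(1 + η) / (2 n)` and symbol
`(i, !v i)` gets mass `(1 - η) / (2 n)`. -/
noncomputable def hardInstance {n k : ℕ} (e : Fin n × Bool ≃ Fin k) (η : ℝ) (v : Fin n → Bool)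
    (x : Fin k) : ℝ :=
  (1 - η) / (2 * n) + if (e.symm x).2 = v (e.symm x).1 then η / n else 0

lemma hardInstance_nonneg {n k : ℕ} (e : Fin n × Bool ≃ Fin k) {η : ℝ} (h0 : 0 ≤ η) (h1 : η ≤ 1)
    (v : Fin n → Bool) (x : Fin k) : 0 ≤ hardInstance e η v x := by
  have : 0 ≤ 1 - η := by linarith
  unfold hardInstance
  split_ifs <;> positivity

lemma sum_hardInstance {n k : ℕ} (hn : 0 < n) (e : Fin n × Bool ≃ Fin k) (η : ℝ)
    (v : Fin n → Bool) : ∑ x, hardInstance e η v x = 1 := by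
  have hn' : (n : ℝ) ≠ 0 := by positivity
  have hpair : ∀ i : Fin n, ∑ b : Bool, hardInstance e η v (e (i, b)) = 1 / n := by
    intro i
    cases hv : v i <;> simp [hardInstance, hv] <;> field_simp <;> ring
  rw [← e.sum_comp, Fintype.sum_prod_type, Finset.sum_congr rfl fun i _ => hpair i]
  simp [hn']

lemma map_sourceMeasure {n k : ℕ} (e : Fin n × Bool ≃ Fin k) {η : ℝ} (h0 : 0 ≤ η) (h1 : η ≤ 1)
    (v : Fin n → Bool) :
    (sourceMeasure n η).map (readSymbol e v) = discMeasure (hardInstance e η v) := by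
  have hmeas : Measurable (readSymbol e v) := measurable_of_finite _
  have h1' : 0 ≤ (1 - η) / (2 * n) := div_nonneg (by linarith) (by positivity)
  have h2 : 0 ≤ η / (2 * n) := by positivity
  have h3 : ENNReal.ofReal (η / n) = ENNReal.ofReal (η / (2 * n)) + ENNReal.ofReal (η / (2 * n)) := by
    rw [← ENNReal.ofReal_add h2 h2]
    congr 1
    ring
  have hadd : ENNReal.ofReal ((1 - η) / (2 * n) + η / n) = ENNReal.ofReal ((1 - η) / (2 * n)) +
      (ENNReal.ofReal (η / (2 * n)) + ENNReal.ofReal (η / (2 * n))) := by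
    rw [← h3, ENNReal.ofReal_add h1' (by positivity)]
  unfold discMeasure sourceMeasure
  rw [← e.sum_comp, Fintype.sum_prod_type, ← Measure.mapₗ_apply_of_measurable hmeas, map_sum]
  refine Finset.sum_congr rfl fun i _ => ?_
  rw [map_sum]
  simp only [Measure.mapₗ_apply_of_measurable hmeas, Measure.map_add _ _ hmeas, Measure.map_smul,
    Measure.map_dirac' hmeas, Fintype.sum_bool]
  cases hv : v i <;> simp [hardInstance, readSymbol, hv, hadd, add_smul] <;> abel

lemma isProbabilityMeasure_sourceMeasure {n : ℕ} (hn : 0 < n) {η : ℝ} (h0 : 0 ≤ η) (h1 : η ≤ 1) :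
    IsProbabilityMeasure (sourceMeasure n η) := by
  have hn' : (n : ℝ) ≠ 0 := by positivity
  have h1' : 0 ≤ (1 - η) / (2 * n) := div_nonneg (by linarith) (by positivity)
  have h2 : 0 ≤ η / (2 * n) := by positivity
  refine ⟨?_⟩
  simp only [sourceMeasure, Measure.coe_finsetSum, Finset.sum_apply, Measure.add_apply,
    Measure.smul_apply, measure_univ, smul_eq_mul, mul_one]
  rw [← ENNReal.ofReal_add h1' h2]
  simp only [Finset.sum_const, Finset.card_univ, Fintype.card_bool, Fintype.card_fin, nsmul_eq_mul]
  rw [← ENNReal.ofReal_natCast n, ← ENNReal.ofReal_natCast 2, ← ENNReal.ofReal_mul (by positivity),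
    ← ENNReal.ofReal_mul (by positivity), ← ENNReal.ofReal_one]
  congr 1
  push_cast
  field_simp
  ring

/-- The source points whose symbol depends on the `i`-th sign. -/
def sensitiveSet {n : ℕ} (i : Fin n) : Set (Fin n × Bool × Bool) :=
  {ω | ω.1 = i ∧ ω.2.2 = true}

lemma sourceMeasure_sensitiveSet {n : ℕ} {η : ℝ} (h0 : 0 ≤ η) (i : Fin n) :
    sourceMeasure n η (sensitiveSet i) = ENNReal.ofReal (η / n) := by
  have h2 : 0 ≤ η / (2 * n) := by positivity
  have hsum : η / n = η / (2 * n) + η / (2 * n) := by ring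
  rw [hsum, ENNReal.ofReal_add h2 h2]
  simp [sourceMeasure, sensitiveSet, Set.indicator_apply, Finset.sum_add_distrib]

/-- Flipping the `i`-th sign. -/
def flipSign {n : ℕ} (i : Fin n) (v : Fin n → Bool) : Fin n → Bool :=
  Function.update v i (!v i)

lemma flipSign_involutive {n : ℕ} (i : Fin n) : Function.Involutive (flipSign i) := by
  intro v
  simp [flipSign]

lemma readSymbol_flipSign {n k : ℕ} (e : Fin n × Bool ≃ Fin k) (i : Fin n) (v : Fin n → Bool)
    {ω : Fin n × Bool × Bool} (hω : ω ∉ sensitiveSet i) :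
    readSymbol e v ω = readSymbol e (flipSign i v) ω := by
  obtain ⟨j, b, o⟩ := ω
  cases o
  · simp [readSymbol]
  · have hj : j ≠ i := by simpa [sensitiveSet] using hω
    simp [readSymbol, flipSign, hj]

/-- The `ℓ1` loss restricted to the `i`-th pair of symbols. -/
noncomputable def pairLoss {n k : ℕ} (e : Fin n × Bool ≃ Fin k) (i : Fin n) (p q : Fin k → ℝ) : ℝ :=
  ∑ b : Bool, |p (e (i, b)) - q (e (i, b))|

lemma pairLoss_nonneg {n k : ℕ} (e : Fin n × Bool ≃ Fin k) (i : Fin n) (p q : Fin k → ℝ) :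
    0 ≤ pairLoss e i p q :=
  Finset.sum_nonneg fun _ _ => abs_nonneg _

lemma sum_pairLoss {n k : ℕ} (e : Fin n × Bool ≃ Fin k) (p q : Fin k → ℝ) :
    ∑ i, pairLoss e i p q = ∑ x, |p x - q x| := by
  rw [← e.sum_comp, Fintype.sum_prod_type]
  rfl

lemma le_pairLoss_add_pairLoss_flipSign {n k : ℕ} (e : Fin n × Bool ≃ Fin k) (i : Fin n) (η : ℝ)
    (v : Fin n → Bool) (q : Fin k → ℝ) :
    2 * (η / n) ≤ pairLoss e i (hardInstance e η v) q +
      pairLoss e i (hardInstance e η (flipSign i v)) q := by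
  have key : ∀ a b x y z : ℝ, 2 * z ≤ |a + z - x| + |b - y| + (|a - x| + |b + z - y|) := by
    intro a b x y z
    have h1 := le_abs_self (a + z - x)
    have h2 := neg_abs_le (a - x)
    have h3 := le_abs_self (b + z - y)
    have h4 := neg_abs_le (b - y)
    linarith
  have key' : ∀ a b x y z : ℝ, 2 * z ≤ |a - x| + |b + z - y| + (|a + z - x| + |b - y|) := by
    intro a b x y z
    linarith [key a b x y z]
  cases hv : v i
  · simpa [pairLoss, hardInstance, flipSign, hv] using key' _ _ _ _ _
  · simpa [pairLoss, hardInstance, flipSign, hv] using key _ _ _ _ _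

/-- Two-point bound: if two losses always sum to at least `2 d` and the two measures are
`τ`-close on events, the losses cannot both be small. -/
lemma le_lintegral_add_lintegral {Θ : Type*} [MeasurableSpace Θ] {μ μ' : Measure Θ}
    [IsProbabilityMeasure μ'] {f f' : Θ → ℝ} (hf : Measurable f) (hf' : Measurable f')
    {d : ℝ} (hff' : ∀ q, 2 * d ≤ f q + f' q) {τ : ℝ≥0∞}
    (hτ : ∀ S, MeasurableSet S → μ' S ≤ μ S + τ) :
    ENNReal.ofReal d ≤ (∫⁻ q, ENNReal.ofReal (f q) ∂μ) + (∫⁻ q, ENNReal.ofReal (f' q) ∂μ') +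
      ENNReal.ofReal d * τ := by
  set S : Set Θ := {q | d ≤ f q}
  have hS : MeasurableSet S := measurableSet_le measurable_const hf
  have h1 : ENNReal.ofReal d * μ S ≤ ∫⁻ q, ENNReal.ofReal (f q) ∂μ :=
    (mul_le_mul_right (measure_mono fun q hq => ENNReal.ofReal_le_ofReal hq) _).trans
      (mul_meas_ge_le_lintegral hf.ennreal_ofReal _)
  have h2 : ENNReal.ofReal d * μ' Sᶜ ≤ ∫⁻ q, ENNReal.ofReal (f' q) ∂μ' := by
    refine (mul_le_mul_right (measure_mono fun q hq => ENNReal.ofReal_le_ofReal ?_) _).trans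
      (mul_meas_ge_le_lintegral hf'.ennreal_ofReal _)
    have hq' : f q < d := not_le.1 hq
    linarith [hff' q]
  calc ENNReal.ofReal d = ENNReal.ofReal d * (μ' S + μ' Sᶜ) := by
        rw [measure_add_measure_compl hS, measure_univ, mul_one]
    _ ≤ ENNReal.ofReal d * (μ S + τ + μ' Sᶜ) := by
        gcongr
        exact hτ S hS
    _ = ENNReal.ofReal d * μ S + ENNReal.ofReal d * μ' Sᶜ + ENNReal.ofReal d * τ := by ring
    _ ≤ _ := by gcongr

open Classical in
/-- The positions of the samples lying in `E`. -/
noncomputable def hits {Ω : Type*} {s m : ℕ} (E : Set Ω) (Z : Fin s → Fin m → Ω) :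
    Finset (Fin s × Fin m) :=
  Finset.univ.filter fun x => Z x.1 x.2 ∈ E

/-- The expected number of users (plus one) filled by the samples lying in `E`. -/
lemma lintegral_card_div_add_one_le {Ω : Type*} [MeasurableSpace Ω]
    [MeasurableSingletonClass Ω] [Finite Ω]
    (ν : Measure Ω) [IsProbabilityMeasure ν] (E : Set Ω) {s m : ℕ}
    (hm : 0 < m) :
    ∫⁻ Z, (((hits E Z).card / m + 1 : ℕ) : ℝ≥0∞)
      ∂(Measure.pi fun _ : Fin s => Measure.pi fun _ : Fin m => ν) ≤ s * ν E + 1 := by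
  have hm0 : (m : ℝ≥0∞) ≠ 0 := by exact_mod_cast hm.ne'
  have hmt : (m : ℝ≥0∞) ≠ ∞ := ENNReal.natCast_ne_top m
  have hE : MeasurableSet E := E.toFinite.measurableSet
  set P := Measure.pi fun _ : Fin s => Measure.pi fun _ : Fin m => ν
  have hcard : ∫⁻ Z, ((hits E Z).card : ℝ≥0∞) ∂P = s * m * ν E := by
    have hpt : ∀ Z : Fin s → Fin m → Ω,
        ((hits E Z).card : ℝ≥0∞) = ∑ x : Fin s × Fin m, E.indicator 1 (Z x.1 x.2) := by
      intro Z
      classical simp [hits, Set.indicator_apply]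
    have hpres : ∀ x : Fin s × Fin m, MeasurePreserving
        (fun Z : Fin s → Fin m → Ω => Z x.1 x.2) P ν := fun x =>
      (measurePreserving_eval (fun _ : Fin m => ν) x.2).comp
        (measurePreserving_eval (fun _ : Fin s => Measure.pi fun _ : Fin m => ν) x.1)
    simp_rw [hpt]
    have hind : Measurable (E.indicator (1 : Ω → ℝ≥0∞)) := measurable_one.indicator hE
    rw [lintegral_finsetSum _ fun x _ => by exact hind.comp (hpres x).measurable,
      Finset.sum_congr rfl fun x _ => ((hpres x).lintegral_comp hind).trans
      (lintegral_indicator_one hE)]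
    simp
  have hdiv : ∀ Z : Fin s → Fin m → Ω,
      (((hits E Z).card / m + 1 : ℕ) : ℝ≥0∞) ≤
      ((hits E Z).card : ℝ≥0∞) * (m : ℝ≥0∞)⁻¹ + 1 := by
    intro Z
    push_cast
    gcongr
    rw [← div_eq_mul_inv, ENNReal.le_div_iff_mul_le (Or.inl hm0) (Or.inl hmt)]
    exact_mod_cast Nat.div_mul_le_self _ _
  calc _ ≤ ∫⁻ Z, (((hits E Z).card : ℝ≥0∞) * (m : ℝ≥0∞)⁻¹ + 1) ∂P := lintegral_mono hdiv
    _ = s * m * ν E * (m : ℝ≥0∞)⁻¹ + 1 := by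
        rw [lintegral_add_right _ measurable_const, lintegral_mul_const' _ _ (by simp [hm0]), hcard]
        simp
    _ = s * ν E * (m * (m : ℝ≥0∞)⁻¹) + 1 := by ring
    _ = s * ν E + 1 := by rw [ENNReal.mul_inv_cancel hm0 hmt, mul_one]

lemma lintegral_pi_discMeasure_hardInstance {n k s m : ℕ} (hn : 0 < n)
    (e : Fin n × Bool ≃ Fin k) {η : ℝ} (h0 : 0 ≤ η) (h1 : η ≤ 1) (v : Fin n → Bool)
    (G : (Fin s → Fin m → Fin k) → ℝ≥0∞) :
    ∫⁻ D, G D ∂(Measure.pi fun _ : Fin s => Measure.pi fun _ : Fin m =>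
        discMeasure (hardInstance e η v)) =
      ∫⁻ Z, G (fun u j => readSymbol e v (Z u j))
        ∂(Measure.pi fun _ : Fin s => Measure.pi fun _ : Fin m => sourceMeasure n η) := by
  have := isProbabilityMeasure_sourceMeasure hn h0 h1
  have hmeas : Measurable (readSymbol e v) := measurable_of_finite _
  have hpres : MeasurePreserving (readSymbol e v) (sourceMeasure n η)
      (discMeasure (hardInstance e η v)) := ⟨hmeas, map_sourceMeasure e h0 h1 v⟩
  have : IsProbabilityMeasure (discMeasure (hardInstance e η v)) := by
    rw [← map_sourceMeasure e h0 h1 v]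
    exact Measure.isProbabilityMeasure_map hmeas.aemeasurable
  have hpi := measurePreserving_pi (fun _ : Fin s => Measure.pi fun _ : Fin m => sourceMeasure n η)
    (fun _ : Fin s => Measure.pi fun _ : Fin m => discMeasure (hardInstance e η v))
    (fun _ => measurePreserving_pi (fun _ : Fin m => sourceMeasure n η)
      (fun _ : Fin m => discMeasure (hardInstance e η v)) fun _ => hpres)
  exact (hpi.lintegral_comp (measurable_of_finite G)).symm

/-- any (ε,δ)-DP (user-level) mechanism whose output distribution depends on the
dataset only through the total counts, outputting a distribution in the simplex, has worst-case
expected ℓ1 error at least `0.1 * min (k/(200 s (ε+δ))) 1`. -/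
theorem stmt0 (k s m : ℕ) (hk : 2 ≤ k) (hke : Even k) (hs : 1 ≤ s) (hm : 1 ≤ m)
    (ε δ : ℝ) (hε : 0 ≤ ε) (hδ : 0 ≤ δ) (hεδ : ε + δ ≤ 0.07)
    (M : (Fin s → Fin m → Fin k) →
      Measure {q : Fin k → ℝ // (∀ i, 0 ≤ q i) ∧ ∑ i, q i = 1})
    (hMprob : ∀ D, IsProbabilityMeasure (M D))
    (hDP : ∀ D D' : Fin s → Fin m → Fin k,
      (∃ u, ∀ v, v ≠ u → D v = D' v) →
      ∀ S : Set {q : Fin k → ℝ // (∀ i, 0 ≤ q i) ∧ ∑ i, q i = 1}, MeasurableSet S →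
        M D S ≤ ENNReal.ofReal (Real.exp ε) * M D' S + ENNReal.ofReal δ)
    (hRestricted : ∃ g : (Fin k → ℕ) →
        Measure {q : Fin k → ℝ // (∀ i, 0 ≤ q i) ∧ ∑ i, q i = 1},
      ∀ D, M D = g (countVec D)) :
    ENNReal.ofReal (0.1 * min ((k : ℝ) / (200 * s * (ε + δ))) 1) ≤
      ⨆ p : {p : Fin k → ℝ // (∀ i, 0 ≤ p i) ∧ ∑ i, p i = 1},
        ∫⁻ D, (∫⁻ q, ENNReal.ofReal (∑ i, |p.1 i - q.1 i|) ∂(M D))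
          ∂(Measure.pi fun _ : Fin s => Measure.pi fun _ : Fin m => discMeasure p.1) := by
  classical
  obtain ⟨g, hg⟩ := hRestricted
  obtain ⟨n, hkn⟩ := hke
  have hn : 0 < n := by omega
  have hnR : (0 : ℝ) < n := by exact_mod_cast hn
  have hsR : (0 : ℝ) < s := by exact_mod_cast hs
  have hkR : (k : ℝ) = 2 * n := by rw [hkn]; push_cast; ring
  have hα : 0 ≤ ε + δ := by linarith
  set η : ℝ := min ((k : ℝ) / (200 * s * (ε + δ))) 1
  have h0 : 0 ≤ η := le_min (by positivity) zero_le_one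
  have h1 : η ≤ 1 := min_le_right _ _
  have hbudget : 2 * (ε + δ) * (s * (η / n) + 1) ≤ 1 / 2 := by
    have hηs : (ε + δ) * s * η ≤ n / 100 := by
      rcases hα.eq_or_lt with hα0 | hα0
      · rw [← hα0]; simp; positivity
      · have hle : η ≤ (k : ℝ) / (200 * s * (ε + δ)) := min_le_left _ _
        rw [le_div_iff₀ (by positivity), hkR] at hle
        linarith
    have : (ε + δ) * s * η / n ≤ 1 / 100 := by
      rw [div_le_iff₀ hnR]; linarith
    have heq : 2 * (ε + δ) * (s * (η / n) + 1) = 2 * ((ε + δ) * s * η / n) + 2 * (ε + δ) := by ring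
    rw [heq]
    norm_num at hεδ ⊢
    linarith
  have e : Fin n × Bool ≃ Fin k := Fintype.equivFinOfCardEq (by simp [hkn]; ring)
  have := isProbabilityMeasure_sourceMeasure hn h0 h1
  set P := Measure.pi fun _ : Fin s => Measure.pi fun _ : Fin m => sourceMeasure n η
  set c : ℝ≥0∞ := ENNReal.ofReal (2 * (ε + δ)) with hc
  set d : ℝ≥0∞ := ENNReal.ofReal (η / n) with hd
  let p : (Fin n → Bool) → {p : Fin k → ℝ // (∀ i, 0 ≤ p i) ∧ ∑ i, p i = 1} := fun v =>
    ⟨hardInstance e η v, hardInstance_nonneg e h0 h1 v, sum_hardInstance hn e η v⟩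
  let H : Fin n → (Fin n → Bool) → ℝ≥0∞ := fun i v =>
    ∫⁻ Z, ∫⁻ q, ENNReal.ofReal (pairLoss e i (hardInstance e η v) q.1)
      ∂(M fun u j => readSymbol e v (Z u j)) ∂P
  have hlossmeas : ∀ i v, Measurable
      fun q : {q : Fin k → ℝ // (∀ i, 0 ≤ q i) ∧ ∑ i, q i = 1} =>
        pairLoss e i (hardInstance e η v) q.1 := by
    intro i v
    have hcoord : ∀ x, Measurable
        fun q : {q : Fin k → ℝ // (∀ i, 0 ≤ q i) ∧ ∑ i, q i = 1} => q.1 x := fun x =>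
      (measurable_pi_apply x).comp measurable_subtype_coe
    exact Finset.measurable_sum _ fun b _ =>
      ((hcoord (e (i, b))).const_sub (hardInstance e η v (e (i, b)))).abs
  have hclose : ∀ i v (Z : Fin s → Fin m → Fin n × Bool × Bool) S, MeasurableSet S →
      M (fun u j => readSymbol e (flipSign i v) (Z u j)) S ≤
        M (fun u j => readSymbol e v (Z u j)) S +
        ((hits (sensitiveSet i) Z).card / m + 1 : ℕ) * c := by
    intro i v Z S hS
    refine le_add_mul_of_perm_invariant (F := fun D => M D S) (fun D D' h => ?_) (fun σ D => ?_)
      (hits (sensitiveSet i) Z) _ ?_ _ _ ?_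
    · exact measure_le_add_of_dp hε (by norm_num at hεδ ⊢; linarith) hδ (hDP D D' h S hS)
    · simp only [hg, countVec_perm]
    · exact (Nat.lt_mul_of_div_lt (Nat.lt_succ_self _) hm).le
    · intro x hx
      exact (readSymbol_flipSign e i v (by simpa [hits] using hx)).symm
  have husers : ∀ i,
      ∫⁻ Z, (((hits (sensitiveSet i) Z).card / m + 1 : ℕ) : ℝ≥0∞) ∂P ≤ s * d + 1 := by
    intro i
    rw [hd, ← sourceMeasure_sensitiveSet h0 i]
    exact lintegral_card_div_add_one_le (sourceMeasure n η) (sensitiveSet i) hm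
  have hpair : ∀ i v, d / 2 ≤ H i v + H i (flipSign i v) := by
    intro i v
    have hint : d ≤ H i v + H i (flipSign i v) + d / 2 := by
      calc d = ∫⁻ _, d ∂P := by simp
        _ ≤ ∫⁻ Z, ((∫⁻ q, ENNReal.ofReal (pairLoss e i (hardInstance e η v) q.1)
              ∂(M fun u j => readSymbol e v (Z u j))) +
            (∫⁻ q, ENNReal.ofReal (pairLoss e i (hardInstance e η (flipSign i v)) q.1)
              ∂(M fun u j => readSymbol e (flipSign i v) (Z u j))) +
            d * (((hits (sensitiveSet i) Z).card / m + 1 : ℕ) * c)) ∂P :=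
            lintegral_mono fun Z => le_lintegral_add_lintegral (hlossmeas i v)
              (hlossmeas i (flipSign i v))
              (fun q => le_pairLoss_add_pairLoss_flipSign e i η v q.1) (hclose i v Z)
        _ = H i v + H i (flipSign i v) +
            d * ((∫⁻ Z, ((hits (sensitiveSet i) Z).card / m + 1 : ℕ) ∂P) * c) := by
            rw [lintegral_add_left (measurable_of_finite _),
              lintegral_add_left (measurable_of_finite _),
              lintegral_const_mul _ (measurable_of_finite _),
              lintegral_mul_const _ (measurable_of_finite _)]
        _ ≤ H i v + H i (flipSign i v) + d * ((s * d + 1) * c) := by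
            gcongr
            exact husers i
        _ ≤ H i v + H i (flipSign i v) + d / 2 := by
            rw [div_eq_mul_inv]
            gcongr
            rw [hd, hc, ← ENNReal.ofReal_natCast s, ← ENNReal.ofReal_mul (by positivity),
              ← ENNReal.ofReal_one, ← ENNReal.ofReal_add (by positivity) zero_le_one,
              ← ENNReal.ofReal_mul (by positivity)]
            refine (ENNReal.ofReal_le_ofReal (q := 2⁻¹) (by linarith)).trans_eq ?_
            rw [ENNReal.ofReal_inv_of_pos two_pos]
            simp
    have hdtop : d / 2 ≠ ∞ := by simp [hd, ENNReal.div_eq_top]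
    rw [← ENNReal.add_halves d] at hint
    exact (ENNReal.add_le_add_iff_right hdtop).1 (by simpa using hint)
  have hsumH : ∀ i, 2 ^ n * (d / 2) ≤ 2 * ∑ v, H i v := by
    intro i
    calc (2 : ℝ≥0∞) ^ n * (d / 2) = ∑ _v : Fin n → Bool, d / 2 := by simp
      _ ≤ ∑ v, (H i v + H i (flipSign i v)) := Finset.sum_le_sum fun v _ => hpair i v
      _ = ∑ v, H i v + ∑ v, H i v := by
          rw [Finset.sum_add_distrib]
          congr 1
          exact Equiv.sum_comp (flipSign_involutive i).toPerm (H i)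
      _ = 2 * ∑ v, H i v := (two_mul _).symm
  set R : ℝ≥0∞ := ⨆ p : {p : Fin k → ℝ // (∀ i, 0 ≤ p i) ∧ ∑ i, p i = 1},
        ∫⁻ D, (∫⁻ q, ENNReal.ofReal (∑ i, |p.1 i - q.1 i|) ∂(M D))
          ∂(Measure.pi fun _ : Fin s => Measure.pi fun _ : Fin m => discMeasure p.1)
  have hrisk : ∀ v, ∑ i, H i v ≤ R := by
    intro v
    refine le_trans (le_of_eq ?_) (le_iSup _ (p v))
    rw [lintegral_pi_discMeasure_hardInstance hn e h0 h1 v,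
      ← lintegral_finsetSum _ fun i _ => measurable_of_finite _]
    refine lintegral_congr fun Z => ?_
    rw [← lintegral_finsetSum _ fun i _ => (hlossmeas i v).ennreal_ofReal]
    refine lintegral_congr fun q => ?_
    rw [← ENNReal.ofReal_sum_of_nonneg fun i _ => pairLoss_nonneg _ _ _ _, sum_pairLoss]
  have htotal : n * (2 ^ n * (d / 2)) ≤ 2 ^ n * (2 * R) := by
    calc (n : ℝ≥0∞) * (2 ^ n * (d / 2)) = ∑ _i : Fin n, 2 ^ n * (d / 2) := by simp
      _ ≤ ∑ i, 2 * ∑ v, H i v := Finset.sum_le_sum fun i _ => hsumH i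
      _ = 2 * ∑ v, ∑ i, H i v := by rw [← Finset.mul_sum, Finset.sum_comm]
      _ ≤ 2 * ∑ _v : Fin n → Bool, R := by
          gcongr with v
          exact hrisk v
      _ = 2 ^ n * (2 * R) := by simp; ring
  have hR2 : n * (d / 2) ≤ 2 * R := by
    rw [mul_left_comm] at htotal
    exact (ENNReal.mul_le_mul_iff_right (by simp) (by simp)).1 htotal
  have hlow : 2 * ENNReal.ofReal (0.1 * η) ≤ n * (d / 2) := by
    have h2 : (2 : ℝ≥0∞) = ENNReal.ofReal 2 := by simp
    rw [hd, h2, ← ENNReal.ofReal_natCast n, ← ENNReal.ofReal_div_of_pos two_pos,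
      ← ENNReal.ofReal_mul zero_le_two, ← ENNReal.ofReal_mul (by positivity)]
    refine ENNReal.ofReal_le_ofReal ?_
    have : (n : ℝ) * (η / n / 2) = η / 2 := by field_simp
    rw [this]
    norm_num
    linarith
  exact (ENNReal.mul_le_mul_iff_right two_ne_zero ENNReal.ofNat_ne_top).1 (hlow.trans hR2)
end

section
/- There exists a universal constant c > 0 such that the following holds. Let k ≥ 2 be even, let s, m ≥ 1, and let ε ∈ (0,1]. Let A be any (ε,0)-differentially private mechanism (with respect to user-level adjacency) on datasets of s users, each holding m samples from [k], outputting an estimate p̂ ∈ Δ_k. Then sup over p ∈ Δ_k of E[ℓ1(p, p̂)] ≥ c · min( √(k/(sm)) + k/(s √m ε), 1 ), where the samples are drawn i.i.d. from p. -/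
open MeasureTheory ProbabilityTheory

section UserLevelLowerBound

open Finset

/-- The probability simplex on `Fin k`. -/
abbrev Simplex (k : ℕ) := {q : Fin k → ℝ // (∀ i, 0 ≤ q i) ∧ ∑ i, q i = 1}

/-- The `ℓ1` distance between two vectors. -/
def l1Dist {k : ℕ} (p q : Fin k → ℝ) : ℝ := ∑ i, |p i - q i|

lemma l1Dist_nonneg {k : ℕ} (p q : Fin k → ℝ) : 0 ≤ l1Dist p q :=
  sum_nonneg fun _ _ => abs_nonneg _

lemma l1Dist_le_two {k : ℕ} (p q : Simplex k) : l1Dist p.1 q.1 ≤ 2 := by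
  calc l1Dist p.1 q.1 ≤ ∑ i, (p.1 i + q.1 i) := sum_le_sum fun i _ => by
        rw [abs_le]; constructor <;> linarith [p.2.1 i, q.2.1 i]
    _ = 2 := by rw [sum_add_distrib, p.2.2, q.2.2]; norm_num

lemma measurable_l1Dist {k : ℕ} (p : Fin k → ℝ) :
    Measurable fun q : Simplex k => l1Dist p q.1 := by
  have : Continuous fun q : Simplex k => l1Dist p q.1 := by
    unfold l1Dist
    exact continuous_finsetSum _ fun i _ =>
      (continuous_const.sub ((continuous_apply i).comp continuous_subtype_val)).abs
  exact this.measurable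

lemma integrable_l1Dist {k : ℕ} (p : Simplex k) (μ : Measure (Simplex k)) [IsFiniteMeasure μ] :
    Integrable (fun q : Simplex k => l1Dist p.1 q.1) μ :=
  Integrable.of_bound (measurable_l1Dist p.1).aestronglyMeasurable 2 <| .of_forall fun q => by
    rw [Real.norm_of_nonneg (l1Dist_nonneg _ _)]
    exact l1Dist_le_two p q

lemma integrable_exp_l1Dist {k : ℕ} (p : Fin k → ℝ) {t : ℝ} (ht : 0 ≤ t)
    (μ : Measure (Simplex k)) [IsFiniteMeasure μ] :
    Integrable (fun q : Simplex k => Real.exp (-(t * l1Dist p q.1))) μ := by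
  refine Integrable.of_bound
    (((measurable_l1Dist p).const_mul t).neg.exp.aestronglyMeasurable) 1 <| .of_forall fun q => ?_
  rw [Real.norm_of_nonneg (Real.exp_pos _).le, Real.exp_le_one_iff, neg_nonpos]
  exact mul_nonneg ht (l1Dist_nonneg _ _)

/-- The probability of a dataset whose samples are i.i.d. from `p`. -/
def dataWeight {k s m : ℕ} (p : Fin k → ℝ) (D : Fin s → Fin m → Fin k) : ℝ :=
  ∏ u, ∏ j, p (D u j)

lemma dataWeight_nonneg {k s m : ℕ} {p : Fin k → ℝ} (hp : ∀ i, 0 ≤ p i)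
    (D : Fin s → Fin m → Fin k) : 0 ≤ dataWeight p D :=
  prod_nonneg fun _ _ => prod_nonneg fun _ _ => hp _

lemma sum_dataWeight {k s m : ℕ} (p : Fin k → ℝ) :
    ∑ D : Fin s → Fin m → Fin k, dataWeight p D = ((∑ i, p i) ^ m) ^ s := by
  simp only [dataWeight]
  rw [Fintype.sum_pow, Fintype.sum_pow]

/-- The expected `ℓ1` error of the mechanism `M` on i.i.d. data from `p`. -/
noncomputable def risk {k s m : ℕ} (M : (Fin s → Fin m → Fin k) → Measure (Simplex k))
    (p : Fin k → ℝ) : ℝ :=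
  ∑ D, dataWeight p D * ∫ q, l1Dist p q.1 ∂(M D)

instance isFiniteMeasure_discMeasure {k : ℕ} (p : Fin k → ℝ) :
    IsFiniteMeasure (discMeasure p) := by
  refine ⟨?_⟩
  simp [discMeasure, Measure.finsetSum_apply, ENNReal.sum_lt_top]

lemma discMeasure_singleton {k : ℕ} (p : Fin k → ℝ) (i : Fin k) :
    discMeasure p {i} = ENNReal.ofReal (p i) := by
  rw [discMeasure, Measure.finsetSum_apply, sum_eq_single i]
  · simp
  · intro j _ hj
    simp [hj]
  · simp

lemma lintegral_eq_ofReal_risk {k s m : ℕ} (M : (Fin s → Fin m → Fin k) → Measure (Simplex k))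
    [∀ D, IsProbabilityMeasure (M D)] (p : Simplex k) :
    ∫⁻ D, (∫⁻ q, ENNReal.ofReal (∑ i, |p.1 i - q.1 i|) ∂(M D))
      ∂(Measure.pi fun _ : Fin s => Measure.pi fun _ : Fin m => discMeasure p.1) =
    ENNReal.ofReal (risk M p.1) := by
  rw [lintegral_fintype, risk, ENNReal.ofReal_sum_of_nonneg]
  · refine sum_congr rfl fun D _ => ?_
    rw [ENNReal.ofReal_mul (dataWeight_nonneg p.2.1 D),
      ofReal_integral_eq_lintegral_ofReal (integrable_l1Dist p _)
        (.of_forall fun q => l1Dist_nonneg _ _), mul_comm]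
    congr 1
    rw [Measure.pi_singleton, dataWeight, ENNReal.ofReal_prod_of_nonneg
      fun _ _ => prod_nonneg fun _ _ => p.2.1 _]
    refine prod_congr rfl fun u _ => ?_
    rw [Measure.pi_singleton, ENNReal.ofReal_prod_of_nonneg fun _ _ => p.2.1 _]
    exact prod_congr rfl fun j _ => discMeasure_singleton _ _
  · intro D _
    exact mul_nonneg (dataWeight_nonneg p.2.1 D) (integral_nonneg fun q => l1Dist_nonneg _ _)

/-- The sign pattern `(σ, -σ)` attached to a point of the hypercube. -/
def signVec {h : ℕ} (θ : Fin h → Bool) : Fin (h + h) → ℝ :=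
  Fin.append (fun i => if θ i then 1 else -1) (fun i => if θ i then -1 else 1)

lemma sum_signVec {h : ℕ} (θ : Fin h → Bool) : ∑ i, signVec θ i = 0 := by
  rw [Fin.sum_univ_add, ← sum_add_distrib]
  refine sum_eq_zero fun i _ => ?_
  simp only [signVec, Fin.append_left, Fin.append_right]
  split_ifs <;> norm_num

lemma signVec_eq_or {h : ℕ} (θ : Fin h → Bool) (i : Fin (h + h)) :
    signVec θ i = 1 ∨ signVec θ i = -1 := by
  refine Fin.addCases (fun i => ?_) (fun i => ?_) i <;>
    simp only [signVec, Fin.append_left, Fin.append_right] <;> split_ifs <;> simp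

lemma signVec_sq {h : ℕ} (θ : Fin h → Bool) (i : Fin (h + h)) : signVec θ i ^ 2 = 1 := by
  rcases signVec_eq_or θ i with hi | hi <;> simp [hi]

/-- The uniform distribution on `2h` points, perturbed by `±α` in relative terms. -/
noncomputable def perturbed {h : ℕ} (α : ℝ) (θ : Fin h → Bool) (i : Fin (h + h)) : ℝ :=
  (1 + α * signVec θ i) / (h + h : ℕ)

lemma one_add_mul_signVec_pos {h : ℕ} {α : ℝ} (h0 : 0 ≤ α) (h1 : α < 1) (θ : Fin h → Bool)
    (i : Fin (h + h)) : 0 < 1 + α * signVec θ i := by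
  rcases signVec_eq_or θ i with hi | hi <;> rw [hi] <;> linarith

lemma sum_one_add_mul_signVec {h : ℕ} (α : ℝ) (θ : Fin h → Bool) :
    ∑ i, (1 + α * signVec θ i) = (h + h : ℕ) := by
  rw [sum_add_distrib, ← mul_sum, sum_signVec]
  simp

lemma sum_sq_one_add_mul_signVec {h : ℕ} (α : ℝ) (θ : Fin h → Bool) :
    ∑ i, (1 + α * signVec θ i) ^ 2 = (h + h : ℕ) * (1 + α ^ 2) := by
  have : ∀ i, (1 + α * signVec θ i) ^ 2 = 2 * (1 + α * signVec θ i) + (α ^ 2 - 1) := fun i => by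
    linear_combination α ^ 2 * signVec_sq θ i
  simp only [this]
  rw [sum_add_distrib, ← mul_sum, sum_one_add_mul_signVec]
  simp only [sum_const, card_univ, Fintype.card_fin, nsmul_eq_mul]
  ring

lemma perturbed_nonneg {h : ℕ} {α : ℝ} (h0 : 0 ≤ α) (h1 : α < 1) (θ : Fin h → Bool)
    (i : Fin (h + h)) : 0 ≤ perturbed α θ i :=
  div_nonneg (one_add_mul_signVec_pos h0 h1 θ i).le (Nat.cast_nonneg _)

lemma sum_perturbed {h : ℕ} (hh : 0 < h) (α : ℝ) (θ : Fin h → Bool) :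
    ∑ i, perturbed α θ i = 1 := by
  unfold perturbed
  rw [← sum_div, sum_one_add_mul_signVec, div_self]
  positivity

lemma exp_neg_add_exp_neg_le {x y : ℝ} (hx : 0 ≤ x) (hy : 0 ≤ y) :
    Real.exp (-x) + Real.exp (-y) ≤ 1 + Real.exp (-(x + y)) := by
  have h1 : Real.exp (-x) ≤ 1 := by simpa using hx
  have h2 : Real.exp (-y) ≤ 1 := by simpa using hy
  rw [neg_add, Real.exp_add]
  nlinarith

lemma one_add_exp_neg_two_le : 1 + Real.exp (-2) ≤ 2 * Real.exp (-(1 / 2)) := by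
  have h1 : Real.exp (-2) = Real.exp (-(1 / 2)) ^ 4 := by
    rw [← Real.exp_nat_mul]; norm_num
  set x := Real.exp (-(1 / 2)) with hx
  have hx2 : x ^ 2 = Real.exp (-1) := by
    rw [hx, ← Real.exp_nat_mul]; norm_num
  have h3 := Real.exp_neg_one_gt_d9
  have h4 := Real.exp_neg_one_lt_d9
  have hx0 : 0 < x := Real.exp_pos _
  rw [← hx2] at h3 h4
  have hlow : 0.6 < x := by nlinarith
  rw [h1]
  nlinarith

/-- A point of the simplex is close to few of the perturbed distributions. -/
lemma sum_exp_neg_l1Dist_perturbed_le {h : ℕ} (hh : 0 < h) {α : ℝ} (hα : 0 < α)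
    (q : Fin (h + h) → ℝ) :
    ∑ θ : Fin h → Bool, Real.exp (-(h / α * l1Dist (perturbed α θ) q)) ≤
      2 ^ h * Real.exp (-(h / 2)) := by
  set K : ℝ := ((h + h : ℕ) : ℝ) with hK
  have hKpos : 0 < K := by positivity
  let g : Fin h → Bool → ℝ := fun i b =>
    |(1 + α * (if b then 1 else -1)) / K - q (Fin.castAdd h i)| +
      |(1 + α * (if b then -1 else 1)) / K - q (Fin.natAdd h i)|
  have hg0 : ∀ i b, 0 ≤ g i b := fun i b => by positivity
  have hg : ∀ i, 4 * α / K ≤ g i true + g i false := fun i => by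
    have e1 := abs_sub_le ((1 + α * 1) / K) (q (Fin.castAdd h i)) ((1 + α * -1) / K)
    have e2 := abs_sub_le ((1 + α * 1) / K) (q (Fin.natAdd h i)) ((1 + α * -1) / K)
    have e3 : (1 + α * 1) / K - (1 + α * -1) / K = 2 * α / K := by ring
    have e4 : |(1 + α * 1) / K - (1 + α * -1) / K| = 2 * α / K := by
      rw [e3, abs_of_pos (by positivity)]
    have e5 : 4 * α / K = 2 * α / K + 2 * α / K := by ring
    rw [e4] at e1 e2
    rw [abs_sub_comm (q _)] at e1 e2
    simp only [g, if_true, Bool.false_eq_true, if_false]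
    linarith
  have hfac : ∀ θ : Fin h → Bool, Real.exp (-(h / α * l1Dist (perturbed α θ) q)) =
      ∏ i, Real.exp (-(h / α * g i (θ i))) := fun θ => by
    rw [← Real.exp_sum, sum_neg_distrib, ← mul_sum, l1Dist, Fin.sum_univ_add, ← sum_add_distrib]
    simp only [perturbed, signVec, Fin.append_left, Fin.append_right, g, hK]
  have hswap := Finset.prod_univ_sum (fun _ : Fin h => (univ : Finset Bool))
    (fun i b => Real.exp (-(h / α * g i b)))
  rw [Fintype.piFinset_univ] at hswap
  simp only [hfac]
  rw [← hswap]
  calc ∏ i, ∑ b, Real.exp (-(h / α * g i b))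
      ≤ ∏ _i : Fin h, (2 * Real.exp (-(1 / 2))) := by
        refine prod_le_prod (fun i _ => sum_nonneg fun b _ => (Real.exp_pos _).le) fun i _ => ?_
        rw [Fintype.sum_bool]
        have hc : (0 : ℝ) ≤ h / α := by positivity
        refine (exp_neg_add_exp_neg_le (mul_nonneg hc (hg0 i _))
          (mul_nonneg hc (hg0 i _))).trans (le_trans ?_ one_add_exp_neg_two_le)
        gcongr
        have h2 : (h / α) * (4 * α / K) = 2 := by
          rw [hK]; push_cast; field_simp; norm_num
        rw [← mul_add, ← h2]
        exact mul_le_mul_of_nonneg_left (hg i) hc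
    _ = 2 ^ h * Real.exp (-(h / 2)) := by
        rw [prod_const, card_univ, Fintype.card_fin, mul_pow, ← Real.exp_nat_mul]
        congr 2; ring

lemma dataWeight_perturbed {h s m : ℕ} (α : ℝ) (θ : Fin h → Bool)
    (D : Fin s → Fin m → Fin (h + h)) :
    dataWeight (perturbed α θ) D =
      dataWeight (fun i => 1 + α * signVec θ i) D / (((h + h : ℕ) : ℝ) ^ m) ^ s := by
  simp [dataWeight, perturbed, prod_div_distrib]

/-- For any fixed output law, the average over the hypercube of the expected `exp` of the negative
scaled error is exponentially small. -/
lemma sum_integral_exp_le {h : ℕ} (hh : 0 < h) {α : ℝ} (hα : 0 < α)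
    (μ : Measure (Simplex (h + h))) [IsProbabilityMeasure μ] :
    ∑ θ : Fin h → Bool, ∫ q, Real.exp (-(h / α * l1Dist (perturbed α θ) q.1)) ∂μ ≤
      2 ^ h * Real.exp (-(h / 2)) := by
  have hint : ∀ θ : Fin h → Bool,
      Integrable (fun q : Simplex (h + h) =>
        Real.exp (-(h / α * l1Dist (perturbed α θ) q.1))) μ :=
    fun θ => integrable_exp_l1Dist _ (by positivity) μ
  rw [← integral_finsetSum _ fun θ _ => hint θ]
  calc _ ≤ ∫ _q : Simplex (h + h), 2 ^ h * Real.exp (-((h : ℝ) / 2)) ∂μ :=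
        integral_mono (integrable_finsetSum _ fun θ _ => hint θ) (integrable_const _)
          fun q => sum_exp_neg_l1Dist_perturbed_le hh hα q.1
    _ = _ := by simp

lemma mul_le_of_log_bounds {L b t : ℝ} (hL : 0 < L) (hb : 0 < b) :
    L * t ≤ L ^ 2 / b + L * Real.log b - 2 * L + Real.exp t := by
  have h1 := Real.add_one_le_exp (t - Real.log L)
  rw [Real.exp_sub, Real.exp_log hL, le_div_iff₀ hL] at h1
  have h2 := Real.log_le_sub_one_of_pos (div_pos hL hb)
  rw [Real.log_div hL.ne' hb.ne'] at h2
  have h3 := mul_le_mul_of_nonneg_left h2 hL.le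
  have h4 : L ^ 2 / b = L * (L / b) := by ring
  nlinarith

/-- Nonprivate lower bound: some perturbed distribution is hard to estimate. -/
lemma exists_le_risk_of_sample_size {h s m : ℕ} (hh : 0 < h)
    (M : (Fin s → Fin m → Fin (h + h)) → Measure (Simplex (h + h)))
    [∀ D, IsProbabilityMeasure (M D)] {α : ℝ} (h0 : 0 < α) (h1 : α < 1)
    (hn : s * m * α ^ 2 ≤ h / 4) :
    ∃ θ : Fin h → Bool, α / 4 ≤ risk M (perturbed α θ) := by
  set K : ℝ := ((h + h : ℕ) : ℝ) with hK
  have hKpos : 0 < K := by positivity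
  set N : ℝ := (K ^ m) ^ s with hN
  have hNpos : 0 < N := by positivity
  set b : ℝ := ((1 + α ^ 2) ^ m) ^ s with hb
  have hbpos : 0 < b := by positivity
  have hlogb : Real.log b ≤ h / 4 := by
    refine le_trans ?_ hn
    rw [hb, Real.log_pow, Real.log_pow, ← mul_assoc]
    have := Real.log_le_sub_one_of_pos (show 0 < 1 + α ^ 2 by positivity)
    gcongr
    linarith
  let L : (Fin h → Bool) → (Fin s → Fin m → Fin (h + h)) → ℝ := fun θ D =>
    dataWeight (fun i => 1 + α * signVec θ i) D
  have hLpos : ∀ θ D, 0 < L θ D := fun θ D =>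
    prod_pos fun _ _ => prod_pos fun _ _ => one_add_mul_signVec_pos h0.le h1 θ _
  have hLsum : ∀ θ, ∑ D, L θ D = N := fun θ => by
    simp only [L]
    rw [sum_dataWeight, sum_one_add_mul_signVec]
  have hLsq : ∀ θ, ∑ D, L θ D ^ 2 = N * b := fun θ => by
    have e : ∀ D, L θ D ^ 2 = dataWeight (fun i => (1 + α * signVec θ i) ^ 2) D := fun D => by
      simp only [L, dataWeight, prod_pow]
    simp only [e]
    rw [sum_dataWeight, sum_sq_one_add_mul_signVec, mul_pow, mul_pow]
  let F : (Fin h → Bool) → (Fin s → Fin m → Fin (h + h)) → ℝ := fun θ D =>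
    ∫ q, Real.exp (-(h / α * l1Dist (perturbed α θ) q.1)) ∂(M D)
  have hpoint : ∀ θ D, L θ D * (h / 2 - h / α * ∫ q, l1Dist (perturbed α θ) q.1 ∂(M D)) ≤
      L θ D ^ 2 / b + L θ D * Real.log b - 2 * L θ D + Real.exp (h / 2) * F θ D := by
    intro θ D
    have hi1 : Integrable (fun q : Simplex (h + h) => l1Dist (perturbed α θ) q.1) (M D) :=
      integrable_l1Dist ⟨perturbed α θ, perturbed_nonneg h0.le h1 θ, sum_perturbed hh α θ⟩ _
    have hi2 := integrable_exp_l1Dist (perturbed α θ) (show (0 : ℝ) ≤ h / α by positivity) (M D)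
    have hmono := integral_mono (μ := M D)
      (((integrable_const ((h : ℝ) / 2)).sub (hi1.const_mul (h / α))).const_mul (L θ D))
      ((integrable_const (L θ D ^ 2 / b + L θ D * Real.log b - 2 * L θ D)).add
        (hi2.const_mul (Real.exp (h / 2))))
      (fun q => by
        have := mul_le_of_log_bounds (t := h / 2 - h / α * l1Dist (perturbed α θ) q.1)
          (hLpos θ D) hbpos
        rw [sub_eq_add_neg (h / 2 : ℝ), Real.exp_add, ← sub_eq_add_neg (h / 2 : ℝ)] at this
        exact this)
    simp only [Pi.add_apply, Pi.sub_apply] at hmono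
    rw [integral_const_mul, integral_sub (integrable_const _) (hi1.const_mul _),
      integral_add (integrable_const _) (hi2.const_mul _), integral_const_mul,
      integral_const_mul] at hmono
    simpa [F] using hmono
  have hθ : ∀ θ, N * (h / 2 - h / α * risk M (perturbed α θ)) ≤
      N * (h / 4) - N + Real.exp (h / 2) * ∑ D, F θ D := by
    intro θ
    have hs := sum_le_sum fun D (_ : D ∈ univ) => hpoint θ D
    rw [sum_add_distrib, sum_sub_distrib, sum_add_distrib, ← sum_div, ← sum_mul, ← mul_sum,
      ← mul_sum, hLsq, hLsum, mul_div_assoc, div_self hbpos.ne'] at hs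
    have e : ∑ D, L θ D * (h / 2 - h / α * ∫ q, l1Dist (perturbed α θ) q.1 ∂(M D)) =
        N * (h / 2 - h / α * risk M (perturbed α θ)) := by
      have : N * risk M (perturbed α θ) =
          ∑ D, L θ D * ∫ q, l1Dist (perturbed α θ) q.1 ∂(M D) := by
        rw [risk, mul_sum]
        refine sum_congr rfl fun D _ => ?_
        rw [dataWeight_perturbed, ← mul_assoc, mul_div_cancel₀ _ hNpos.ne']
      simp only [mul_sub, sum_sub_distrib]
      rw [← sum_mul, hLsum, mul_left_comm, this, mul_sum]
      congr 1
      exact sum_congr rfl fun D _ => by ring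
    rw [e] at hs
    have := mul_le_mul_of_nonneg_left hlogb hNpos.le
    linarith
  have hF : ∑ θ, ∑ D, F θ D ≤ N * (2 ^ h * Real.exp (-(h / 2))) := by
    rw [sum_comm]
    calc ∑ D, ∑ θ, F θ D ≤ ∑ _D : Fin s → Fin m → Fin (h + h), 2 ^ h * Real.exp (-((h : ℝ) / 2)) :=
          sum_le_sum fun D _ => sum_integral_exp_le hh h0 (M D)
      _ = _ := by
          simp only [sum_const, card_univ, Fintype.card_pi, Fintype.card_fin, prod_const,
            nsmul_eq_mul, hN, hK]
          push_cast
          rfl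
  have htot : ∑ θ : Fin h → Bool, (h / 2 - h / α * risk M (perturbed α θ)) ≤
      ∑ _θ : Fin h → Bool, (h / 4 : ℝ) := by
    refine le_of_mul_le_mul_left ?_ hNpos
    rw [mul_sum]
    refine (sum_le_sum fun θ _ => hθ θ).trans ?_
    rw [sum_add_distrib, ← mul_sum]
    have h5 := mul_le_mul_of_nonneg_left hF (Real.exp_pos (h / 2)).le
    have h6 : Real.exp (h / 2) * (N * (2 ^ h * Real.exp (-(h / 2)))) = 2 ^ h * N := by
      rw [Real.exp_neg]; field_simp
    rw [h6] at h5
    simp only [sum_const, card_univ, Fintype.card_pi, Fintype.card_bool, prod_const,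
      Fintype.card_fin, nsmul_eq_mul]
    push_cast
    linarith
  obtain ⟨θ, -, hle⟩ := exists_le_of_sum_le univ_nonempty htot
  refine ⟨θ, ?_⟩
  have h7 : (h : ℝ) / 4 ≤ h / α * risk M (perturbed α θ) := by linarith
  have hpos : (0 : ℝ) < h / α := by positivity
  refine le_of_mul_le_mul_left (le_trans (le_of_eq ?_) h7) hpos
  field_simp

/-- One-user comparison: averaging a function with bounded ratio against two close weights. -/
lemma sum_mul_le_of_ratio_le {X : Type*} [Fintype X] {P Q G : X → ℝ} {r δ : ℝ}
    (hP1 : ∑ x, P x = 1) (hQ : ∀ x, 0 ≤ Q x) (hQ1 : ∑ x, Q x = 1)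
    (hG : ∀ x, 0 ≤ G x) (hr : 1 ≤ r) (hGr : ∀ x y, G x ≤ r * G y)
    (hδ : ∑ x, |P x - Q x| ≤ δ) :
    ∑ x, P x * G x ≤ (1 + δ * (r - 1)) * ∑ x, Q x * G x := by
  have hne : Nonempty X := by
    by_contra hX
    rw [not_nonempty_iff] at hX
    simp at hP1
  obtain ⟨y, hy⟩ := Finite.exists_min G
  have hmin : G y ≤ ∑ x, Q x * G x := by
    calc G y = ∑ x, Q x * G y := by rw [← sum_mul, hQ1, one_mul]
      _ ≤ _ := sum_le_sum fun x _ => mul_le_mul_of_nonneg_left (hy x) (hQ x)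
  have hdiff : ∑ x, P x * G x - ∑ x, Q x * G x = ∑ x, (P x - Q x) * (G x - G y) := by
    simp only [sub_mul, mul_sub, sum_sub_distrib, ← sum_mul, hP1, hQ1]
    ring
  have hbound : ∑ x, (P x - Q x) * (G x - G y) ≤ δ * ((r - 1) * G y) := by
    calc _ ≤ ∑ x, |P x - Q x| * ((r - 1) * G y) := sum_le_sum fun x _ =>
          mul_le_mul (le_abs_self _) (by linarith [hGr x y]) (by linarith [hy x]) (abs_nonneg _)
      _ ≤ _ := by
        rw [← sum_mul]
        exact mul_le_mul_of_nonneg_right hδ (mul_nonneg (by linarith) (hG y))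
  have hδ0 : 0 ≤ δ := (sum_nonneg fun x _ => abs_nonneg _).trans hδ
  have := mul_le_mul_of_nonneg_left hmin (mul_nonneg hδ0 (sub_nonneg.2 hr))
  linarith

/-- Hybrid argument over all users. -/
lemma sum_prod_mul_le_of_ratio_le {X : Type*} [Fintype X] {P Q : X → ℝ} {r δ : ℝ}
    (hP : ∀ x, 0 ≤ P x) (hP1 : ∑ x, P x = 1) (hQ : ∀ x, 0 ≤ Q x) (hQ1 : ∑ x, Q x = 1)
    (hr : 1 ≤ r) (hδ : ∑ x, |P x - Q x| ≤ δ) :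
    ∀ (s : ℕ) (F : (Fin s → X) → ℝ), (∀ D, 0 ≤ F D) →
      (∀ D D' : Fin s → X, (∃ u, ∀ v, v ≠ u → D v = D' v) → F D ≤ r * F D') →
      ∑ D, (∏ u, P (D u)) * F D ≤ (1 + δ * (r - 1)) ^ s * ∑ D, (∏ u, Q (D u)) * F D := by
  have hδ0 : 0 ≤ δ := (sum_nonneg fun x _ => abs_nonneg _).trans hδ
  intro s
  induction s with
  | zero => intro F _ _; simp
  | succ s ih =>
    intro F hF hadj
    have hsplit : ∀ R : X → ℝ, ∑ D, (∏ u, R (D u)) * F D =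
        ∑ x, R x * ∑ D : Fin s → X, (∏ u, R (D u)) * F (Fin.cons x D) := fun R => by
      rw [← (Fin.consEquiv fun _ => X).sum_comp, Fintype.sum_prod_type]
      refine sum_congr rfl fun x _ => ?_
      rw [mul_sum]
      refine sum_congr rfl fun D _ => ?_
      simp [Fin.consEquiv, Fin.prod_univ_succ, mul_assoc]
    rw [hsplit, hsplit]
    set G : X → ℝ := fun x => ∑ D : Fin s → X, (∏ u, Q (D u)) * F (Fin.cons x D) with hG
    have hc : 0 ≤ (1 + δ * (r - 1)) ^ s :=
      pow_nonneg (by nlinarith [mul_nonneg hδ0 (sub_nonneg.2 hr)]) s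
    calc _ ≤ ∑ x, P x * ((1 + δ * (r - 1)) ^ s * G x) := by
          refine sum_le_sum fun x _ => mul_le_mul_of_nonneg_left ?_ (hP x)
          refine ih (fun D => F (Fin.cons x D)) (fun D => hF _) fun D D' ⟨u, hu⟩ => ?_
          refine hadj _ _ ⟨u.succ, fun v hv => ?_⟩
          induction v using Fin.cases with
          | zero => simp
          | succ v => simpa using hu v fun h => hv (by rw [h])
      _ = (1 + δ * (r - 1)) ^ s * ∑ x, P x * G x := by
          rw [mul_sum]; exact sum_congr rfl fun x _ => by ring
      _ ≤ (1 + δ * (r - 1)) ^ s * ((1 + δ * (r - 1)) * ∑ x, Q x * G x) := by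
          refine mul_le_mul_of_nonneg_left ?_ hc
          refine sum_mul_le_of_ratio_le hP1 hQ hQ1 (fun x => ?_) hr (fun x y => ?_) hδ
          · exact sum_nonneg fun D _ => mul_nonneg (prod_nonneg fun _ _ => hQ _) (hF _)
          · simp only [hG, mul_sum]
            refine sum_le_sum fun D _ => ?_
            rw [mul_left_comm]
            refine mul_le_mul_of_nonneg_left ?_ (prod_nonneg fun _ _ => hQ _)
            refine hadj _ _ ⟨0, fun v hv => ?_⟩
            induction v using Fin.cases with
            | zero => exact absurd rfl hv
            | succ v => simp
      _ = _ := by rw [pow_succ, mul_assoc]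

/-- The `m`-sample laws of a perturbed and the uniform distribution are `2 α √m`-close in `ℓ1`. -/
lemma sum_abs_prod_perturbed_sub_le {h : ℕ} (hh : 0 < h) (m : ℕ) {α : ℝ} (h0 : 0 ≤ α)
    (h1 : α < 1) (θ : Fin h → Bool) :
    ∑ x : Fin m → Fin (h + h), |∏ j, perturbed α θ (x j) - ∏ _j : Fin m, 1 / ((h + h : ℕ) : ℝ)| ≤
      2 * (α * Real.sqrt m) := by
  set K : ℝ := ((h + h : ℕ) : ℝ) with hK
  have hKpos : 0 < K := by positivity
  have hα : 0 ≤ α * Real.sqrt m := by positivity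
  by_cases hbig : 1 < α * Real.sqrt m
  · calc _ ≤ ∑ x : Fin m → Fin (h + h),
          (∏ j, perturbed α θ (x j) + ∏ _j : Fin m, 1 / K) := by
          refine sum_le_sum fun x _ => ?_
          have e1 : 0 ≤ ∏ j, perturbed α θ (x j) :=
            prod_nonneg fun _ _ => perturbed_nonneg h0 h1 _ _
          have e2 : 0 ≤ ∏ _j : Fin m, 1 / K := prod_nonneg fun _ _ => by positivity
          rw [abs_le]; constructor <;> linarith
      _ = 2 := by
          rw [sum_add_distrib, ← Fintype.sum_pow, sum_perturbed hh,
            ← Fintype.sum_pow (fun _ : Fin (h + h) => 1 / K)]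
          simp only [sum_const, card_univ, Fintype.card_fin, nsmul_eq_mul, ← hK]
          rw [mul_one_div_cancel hKpos.ne']
          norm_num
      _ ≤ _ := by linarith
  · have hsm : α ^ 2 * m ≤ 1 := by
      have : (α * Real.sqrt m) ^ 2 ≤ 1 := by nlinarith
      rwa [mul_pow, Real.sq_sqrt (Nat.cast_nonneg m)] at this
    set L : (Fin m → Fin (h + h)) → ℝ := fun x => ∏ j, (1 + α * signVec θ (x j)) with hL
    have hLs : ∑ x, L x = K ^ m := by
      simp only [hL]
      rw [← Fintype.sum_pow (fun i => 1 + α * signVec θ i), sum_one_add_mul_signVec]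
    have hLsq : ∑ x, L x ^ 2 = K ^ m * (1 + α ^ 2) ^ m := by
      simp only [hL, ← prod_pow]
      rw [← Fintype.sum_pow (fun i => (1 + α * signVec θ i) ^ 2), sum_sq_one_add_mul_signVec,
        mul_pow]
    have hcard : ((univ : Finset (Fin m → Fin (h + h))).card : ℝ) = K ^ m := by
      simp [hK]
    have hvar : ∑ x, |L x - 1| ^ 2 ≤ K ^ m * (2 * (α * Real.sqrt m)) ^ 2 := by
      simp only [sq_abs, sub_sq, mul_one, one_pow]
      rw [sum_add_distrib, sum_sub_distrib, ← mul_sum, hLs, hLsq, sum_const, nsmul_eq_mul, hcard]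
      have e1 : (1 + α ^ 2) ^ m ≤ Real.exp (α ^ 2 * m) := by
        rw [mul_comm, Real.exp_nat_mul]
        exact pow_le_pow_left₀ (by positivity) (by linarith [Real.add_one_le_exp (α ^ 2)]) m
      have e2 : Real.exp (α ^ 2 * m) ≤ 1 + 2 * (α ^ 2 * m) := by
        have := Real.abs_exp_sub_one_le (x := α ^ 2 * m)
          (by rw [abs_of_nonneg (by positivity)]; exact hsm)
        rw [abs_of_nonneg (a := α ^ 2 * m) (by positivity)] at this
        linarith [le_abs_self (Real.exp (α ^ 2 * m) - 1)]
      have e3 : (2 * (α * Real.sqrt m)) ^ 2 = 4 * (α ^ 2 * m) := by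
        rw [mul_pow, mul_pow, Real.sq_sqrt (Nat.cast_nonneg m)]; norm_num
      rw [e3]
      have e4 : 0 ≤ α ^ 2 * m := by positivity
      have := mul_le_mul_of_nonneg_left
        (show (1 + α ^ 2) ^ m - 1 ≤ 4 * (α ^ 2 * m) by linarith) (pow_pos hKpos m).le
      linarith
    have hcs := sq_sum_le_card_mul_sum_sq (s := univ) (f := fun x => |L x - 1|)
    rw [hcard] at hcs
    have hle : ∑ x, |L x - 1| ≤ K ^ m * (2 * (α * Real.sqrt m)) := by
      refine abs_le_of_sq_le_sq' ?_ (by positivity) |>.2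
      refine hcs.trans ?_
      have := mul_le_mul_of_nonneg_left hvar (pow_pos hKpos m).le
      linarith
    have e : ∀ x : Fin m → Fin (h + h), |∏ j, perturbed α θ (x j) - ∏ _j : Fin m, 1 / K| =
        |L x - 1| / K ^ m := fun x => by
      simp only [perturbed, prod_div_distrib, prod_const, card_univ, Fintype.card_fin, ← hK, one_pow]
      rw [← sub_div, abs_div, abs_of_pos (pow_pos hKpos m)]
    simp only [e]
    rw [← sum_div, div_le_iff₀ (pow_pos hKpos m)]
    linarith

/-- Private lower bound: some perturbed distribution is hard to estimate. -/
lemma exists_le_risk_of_private {h s m : ℕ} (hh : 0 < h) {ε : ℝ} (hε0 : 0 < ε) (hε1 : ε ≤ 1)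
    (M : (Fin s → Fin m → Fin (h + h)) → Measure (Simplex (h + h)))
    [∀ D, IsProbabilityMeasure (M D)]
    (hM : ∀ D D' : Fin s → Fin m → Fin (h + h), (∃ u, ∀ v, v ≠ u → D v = D' v) →
      ∀ S, MeasurableSet S → M D S ≤ ENNReal.ofReal (Real.exp ε) * M D' S)
    {α : ℝ} (h0 : 0 < α) (h1 : α < 1) (hn : s * (4 * (α * Real.sqrt m) * ε) ≤ h / 4) :
    ∃ θ : Fin h → Bool, α / 4 ≤ risk M (perturbed α θ) := by
  set K : ℝ := ((h + h : ℕ) : ℝ) with hK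
  have hKpos : 0 < K := by positivity
  set U : Fin (h + h) → ℝ := fun _ => 1 / K with hU
  have hU1 : ∑ i, U i = 1 := by
    simp only [hU, sum_const, card_univ, Fintype.card_fin, nsmul_eq_mul, ← hK]
    exact mul_one_div_cancel hKpos.ne'
  have hU0 : ∀ i, 0 ≤ U i := fun i => by positivity
  have hint : ∀ θ D, Integrable (fun q : Simplex (h + h) =>
      Real.exp (-(h / α * l1Dist (perturbed α θ) q.1))) (M D) :=
    fun θ D => integrable_exp_l1Dist _ (by positivity) _
  let F : (Fin h → Bool) → (Fin s → Fin m → Fin (h + h)) → ℝ := fun θ D =>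
    ∫ q, Real.exp (-(h / α * l1Dist (perturbed α θ) q.1)) ∂(M D)
  have hF0 : ∀ θ D, 0 ≤ F θ D := fun θ D => integral_nonneg fun q => (Real.exp_pos _).le
  have hFadj : ∀ θ, ∀ D D' : Fin s → Fin m → Fin (h + h), (∃ u, ∀ v, v ≠ u → D v = D' v) →
      F θ D ≤ Real.exp ε * F θ D' := by
    intro θ D D' hadj
    have hle : M D ≤ ENNReal.ofReal (Real.exp ε) • M D' :=
      Measure.le_iff.2 fun S hS => by simpa using hM D D' hadj S hS
    have := integral_mono_measure hle (.of_forall fun q => (Real.exp_pos _).le)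
      ((hint θ D').smul_measure ENNReal.ofReal_ne_top)
    rw [integral_smul_measure, ENNReal.toReal_ofReal (Real.exp_pos _).le] at this
    exact this
  have hhyb : ∀ θ, ∑ D, dataWeight (perturbed α θ) D * F θ D ≤
      Real.exp (h / 4) * ∑ D, dataWeight U D * F θ D := by
    intro θ
    have key := sum_prod_mul_le_of_ratio_le (X := Fin m → Fin (h + h))
      (P := fun x => ∏ j, perturbed α θ (x j)) (Q := fun x => ∏ j, U (x j))
      (fun x => prod_nonneg fun _ _ => perturbed_nonneg h0.le h1 _ _)
      (by rw [← Fintype.sum_pow, sum_perturbed hh, one_pow])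
      (fun x => prod_nonneg fun j _ => hU0 (x j))
      (by rw [← Fintype.sum_pow, hU1, one_pow])
      (Real.one_le_exp hε0.le) (sum_abs_prod_perturbed_sub_le hh m h0.le h1 θ)
      s (F θ) (hF0 θ) (hFadj θ)
    refine key.trans (mul_le_mul_of_nonneg_right ?_ (sum_nonneg fun D _ =>
      mul_nonneg (dataWeight_nonneg hU0 D) (hF0 θ D)))
    have e1 : Real.exp ε - 1 ≤ 2 * ε := by
      have := Real.abs_exp_sub_one_le (x := ε) (by rwa [abs_of_pos hε0])
      rw [abs_of_pos hε0] at this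
      exact (le_abs_self _).trans this
    have e2 : 0 ≤ Real.exp ε - 1 := sub_nonneg.2 (Real.one_le_exp hε0.le)
    have e3 : 1 + 2 * (α * Real.sqrt m) * (Real.exp ε - 1) ≤
        Real.exp (4 * (α * Real.sqrt m) * ε) := by
      refine le_trans ?_ (Real.add_one_le_exp _)
      have := mul_le_mul_of_nonneg_left e1 (show 0 ≤ 2 * (α * Real.sqrt m) by positivity)
      linarith
    refine (pow_le_pow_left₀ (by positivity) e3 s).trans ?_
    rw [← Real.exp_nat_mul]
    exact Real.exp_le_exp.2 hn
  have hsum : ∑ θ, ∑ D, dataWeight (perturbed α θ) D * F θ D ≤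
      ∑ _θ : Fin h → Bool, Real.exp (-((h : ℝ) / 4)) := by
    calc _ ≤ ∑ θ, Real.exp (h / 4) * ∑ D, dataWeight U D * F θ D :=
          sum_le_sum fun θ _ => hhyb θ
      _ = Real.exp (h / 4) * ∑ D, dataWeight U D * ∑ θ, F θ D := by
          rw [← mul_sum, sum_comm]
          simp only [mul_sum]
      _ ≤ Real.exp (h / 4) * ∑ D : Fin s → Fin m → Fin (h + h),
            dataWeight U D * (2 ^ h * Real.exp (-(h / 2))) := by
          gcongr with D _
          · exact dataWeight_nonneg hU0 D
          · exact sum_integral_exp_le hh h0 (M D)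
      _ = _ := by
          rw [← sum_mul, sum_dataWeight, hU1]
          simp only [one_pow, one_mul, sum_const, card_univ, Fintype.card_pi, Fintype.card_bool,
            prod_const, Fintype.card_fin, nsmul_eq_mul]
          push_cast
          rw [mul_left_comm, ← Real.exp_add]
          congr 2
          ring
  obtain ⟨θ, -, hle⟩ := exists_le_of_sum_le univ_nonempty hsum
  refine ⟨θ, ?_⟩
  have hJ : ∀ D, Real.exp (-(h / 4)) *
      (1 + h / 4 - h / α * ∫ q, l1Dist (perturbed α θ) q.1 ∂(M D)) ≤ F θ D := by
    intro D
    have hi1 : Integrable (fun q : Simplex (h + h) => l1Dist (perturbed α θ) q.1) (M D) :=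
      integrable_l1Dist ⟨perturbed α θ, perturbed_nonneg h0.le h1 θ, sum_perturbed hh α θ⟩ _
    have hmono := integral_mono (μ := M D)
      (((integrable_const (1 + (h : ℝ) / 4)).sub (hi1.const_mul (h / α))).const_mul
        (Real.exp (-(h / 4)))) (hint θ D)
      (fun q => by
        have e1 := Real.add_one_le_exp (h / 4 - h / α * l1Dist (perturbed α θ) q.1)
        have e2 : Real.exp (-(h / α * l1Dist (perturbed α θ) q.1)) =
            Real.exp (-(h / 4)) * Real.exp (h / 4 - h / α * l1Dist (perturbed α θ) q.1) := by
          rw [← Real.exp_add]; congr 1; ring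
        simp only [Pi.sub_apply]
        rw [e2]
        exact mul_le_mul_of_nonneg_left (by linarith) (Real.exp_pos _).le)
    simp only [Pi.sub_apply] at hmono
    rw [integral_const_mul, integral_sub (integrable_const _) (hi1.const_mul _),
      integral_const_mul] at hmono
    simpa [F] using hmono
  have hw1 : ∑ D : Fin s → Fin m → Fin (h + h), dataWeight (perturbed α θ) D = 1 := by
    rw [sum_dataWeight, sum_perturbed hh, one_pow, one_pow]
  have hrisk : Real.exp (-(h / 4)) * (1 + h / 4 - h / α * risk M (perturbed α θ)) ≤
      Real.exp (-(h / 4)) * 1 := by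
    rw [mul_one]
    refine le_trans (le_of_eq ?_) ((sum_le_sum fun D _ => mul_le_mul_of_nonneg_left (hJ D)
      (dataWeight_nonneg (perturbed_nonneg h0.le h1 θ) D)).trans hle)
    simp only [mul_left_comm (dataWeight _ _), ← mul_sum]
    congr 1
    simp only [mul_sub, sum_sub_distrib, ← sum_mul, hw1, one_mul, risk, mul_sum,
      mul_left_comm (dataWeight _ _)]
  have h7 := le_of_mul_le_mul_left hrisk (Real.exp_pos _)
  have hpos : (0 : ℝ) < h / α := by positivity
  refine le_of_mul_le_mul_left (show (h / α) * (α / 4) ≤ _ from ?_) hpos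
  have e : (h / α) * (α / 4) = (h : ℝ) / 4 := by field_simp
  rw [e]
  linarith

lemma min_add_one_le {a b x : ℝ} (h1 : min a 1 ≤ x) (h2 : min b 1 ≤ x) : min (a + b) 1 ≤ 2 * x := by
  rcases le_total a 1 with h | h <;> rcases le_total b 1 with h' | h' <;>
    simp only [min_eq_left, min_eq_right, h, h'] at h1 h2
  · exact (min_le_left _ _).trans (by linarith)
  all_goals exact (min_le_right _ _).trans (by linarith)

lemma exists_hard_distribution {h s m : ℕ} (hh : 0 < h) (hs : 1 ≤ s) (hm : 1 ≤ m) {ε : ℝ}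
    (hε0 : 0 < ε) (hε1 : ε ≤ 1)
    (M : (Fin s → Fin m → Fin (h + h)) → Measure (Simplex (h + h)))
    [∀ D, IsProbabilityMeasure (M D)]
    (hM : ∀ D D' : Fin s → Fin m → Fin (h + h), (∃ u, ∀ v, v ≠ u → D v = D' v) →
      ∀ S, MeasurableSet S → M D S ≤ ENNReal.ofReal (Real.exp ε) * M D' S) :
    ∃ p : Simplex (h + h), 1 / 256 * min
      (Real.sqrt (((h + h : ℕ) : ℝ) / (s * m)) + ((h + h : ℕ) : ℝ) / (s * Real.sqrt m * ε)) 1 ≤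
        risk M p.1 := by
  set A := Real.sqrt (((h + h : ℕ) : ℝ) / (s * m)) with hA
  set B := ((h + h : ℕ) : ℝ) / (s * Real.sqrt m * ε) with hB
  have hs' : (0 : ℝ) < s := by exact_mod_cast hs
  have hm' : (0 : ℝ) < m := by exact_mod_cast hm
  have hsq : 0 < Real.sqrt m := Real.sqrt_pos.2 hm'
  have hh' : (0 : ℝ) < h := by exact_mod_cast hh
  have hApos : 0 < A := Real.sqrt_pos.2 (by positivity)
  have hBpos : 0 < B := by positivity
  have hsimp : ∀ {α : ℝ}, 0 < α → α < 1 → (∃ θ : Fin h → Bool, α / 4 ≤ risk M (perturbed α θ)) →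
      ∃ p : Simplex (h + h), α / 4 ≤ risk M p.1 := fun h0 h1 ⟨θ, hθ⟩ =>
    ⟨⟨perturbed _ θ, perturbed_nonneg h0.le h1 θ, sum_perturbed hh _ θ⟩, hθ⟩
  have hp1 : ∃ p : Simplex (h + h), min A 1 / 32 / 4 ≤ risk M p.1 := by
    have hle : min A 1 ≤ A := min_le_left _ _
    have hle1 : min A 1 ≤ 1 := min_le_right _ _
    have hpos : 0 < min A 1 := lt_min hApos one_pos
    refine hsimp (by positivity) (by linarith) (exists_le_risk_of_sample_size hh M
      (by positivity) (by linarith) ?_)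
    have e1 : (min A 1 / 32) ^ 2 ≤ A ^ 2 / 8 := by nlinarith
    have e2 : s * m * (A ^ 2 / 8) = h / 4 := by
      rw [hA, Real.sq_sqrt (by positivity)]; push_cast; field_simp; norm_num
    rw [← e2]
    gcongr
  have hp2 : ∃ p : Simplex (h + h), min B 1 / 32 / 4 ≤ risk M p.1 := by
    have hle : min B 1 ≤ B := min_le_left _ _
    have hle1 : min B 1 ≤ 1 := min_le_right _ _
    have hpos : 0 < min B 1 := lt_min hBpos one_pos
    refine hsimp (by positivity) (by linarith) (exists_le_risk_of_private hh hε0 hε1 M hM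
      (by positivity) (by linarith) ?_)
    have e2 : s * (4 * (B / 32 * Real.sqrt m) * ε) = h / 4 := by
      rw [hB]; push_cast; field_simp; norm_num
    rw [← e2]
    gcongr
  obtain ⟨p1, hp1⟩ := hp1
  obtain ⟨p2, hp2⟩ := hp2
  rcases le_total (min A 1) (min B 1) with hAB | hAB
  · exact ⟨p2, by linarith [min_add_one_le hAB le_rfl]⟩
  · exact ⟨p1, by linarith [min_add_one_le le_rfl hAB]⟩

end UserLevelLowerBound

/-- there is a universal constant `c > 0` such that any (ε,0)-DP (user-level)
mechanism on datasets of `s` users each with `m` samples from `[k]` outputting an estimate in the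
simplex has worst-case expected ℓ1 error at least
`c * min (√(k/(sm)) + k/(s √m ε)) 1`. -/
theorem stmt1 : ∃ c : ℝ, 0 < c ∧
    ∀ (k s m : ℕ), 2 ≤ k → Even k → 1 ≤ s → 1 ≤ m →
    ∀ ε : ℝ, 0 < ε → ε ≤ 1 →
    ∀ M : (Fin s → Fin m → Fin k) →
        Measure {q : Fin k → ℝ // (∀ i, 0 ≤ q i) ∧ ∑ i, q i = 1},
    (∀ D, IsProbabilityMeasure (M D)) →
    (∀ D D' : Fin s → Fin m → Fin k,
      (∃ u, ∀ v, v ≠ u → D v = D' v) →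
      ∀ S : Set {q : Fin k → ℝ // (∀ i, 0 ≤ q i) ∧ ∑ i, q i = 1}, MeasurableSet S →
        M D S ≤ ENNReal.ofReal (Real.exp ε) * M D' S) →
    ENNReal.ofReal (c * min
        (Real.sqrt ((k : ℝ) / (s * m)) + (k : ℝ) / (s * Real.sqrt m * ε)) 1) ≤
      ⨆ p : {p : Fin k → ℝ // (∀ i, 0 ≤ p i) ∧ ∑ i, p i = 1},
        ∫⁻ D, (∫⁻ q, ENNReal.ofReal (∑ i, |p.1 i - q.1 i|) ∂(M D))
          ∂(Measure.pi fun _ : Fin s => Measure.pi fun _ : Fin m => discMeasure p.1) := by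
  refine ⟨1 / 256, by norm_num, ?_⟩
  rintro k s m hk ⟨h, rfl⟩ hs hm ε hε0 hε1 M hMp hM
  obtain ⟨p, hp⟩ := exists_hard_distribution (by omega) hs hm hε0 hε1 M hM
  refine le_trans (ENNReal.ofReal_le_ofReal hp) ?_
  rw [← lintegral_eq_ofReal_risk M p]
  exact le_iSup (fun p : Simplex (h + h) =>
    ∫⁻ D, (∫⁻ q, ENNReal.ofReal (∑ i, |p.1 i - q.1 i|) ∂(M D))
      ∂(Measure.pi fun _ : Fin s => Measure.pi fun _ : Fin m => discMeasure p.1)) p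
end

section
/- For all positive integers m and all p, q ∈ [0,1] with p ∈ (0,1), the ℓ1 distance between binomial distributions satisfies (1/350) · min( m|p−q|, √m |p−q| / √(p(1−p)), 1 ) ≤ ℓ1(Bin(m,p), Bin(m,q)) ≤ 2 · min( m|p−q|, √m |p−q| / √(p(1−p)), 1 ). -/
/-- The probability mass function of the binomial distribution `Bin(m,p)` at `j`. -/
noncomputable def binomPMF (m : ℕ) (p : ℝ) (j : ℕ) : ℝ :=
  (m.choose j : ℝ) * p ^ j * (1 - p) ^ (m - j)

/-- The ℓ1 distance between the binomial distributions `Bin(m,p)` and `Bin(m,q)`. -/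
noncomputable def binomL1 (m : ℕ) (p q : ℝ) : ℝ :=
  ∑ j ∈ Finset.range (m + 1), |binomPMF m p j - binomPMF m q j|

open Finset

lemma binomPMF_nonneg {x : ℝ} (hx0 : 0 ≤ x) (hx1 : x ≤ 1) (m j : ℕ) : 0 ≤ binomPMF m x j := by
  have : 0 ≤ 1 - x := by linarith
  unfold binomPMF
  positivity

lemma binomPMF_eq_zero_of_lt (x : ℝ) {m j : ℕ} (h : m < j) : binomPMF m x j = 0 := by
  simp [binomPMF, Nat.choose_eq_zero_of_lt h]

lemma binomPMF_succ_zero (m : ℕ) (x : ℝ) :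
    binomPMF (m + 1) x 0 = (1 - x) * binomPMF m x 0 := by
  simp [binomPMF, pow_succ']

lemma binomPMF_succ_succ (m : ℕ) (x : ℝ) (j : ℕ) :
    binomPMF (m + 1) x (j + 1) = x * binomPMF m x j + (1 - x) * binomPMF m x (j + 1) := by
  rcases lt_or_ge j m with h | h
  · obtain ⟨d, rfl⟩ := Nat.exists_eq_add_of_lt h
    have h1 : j + d + 1 + 1 - (j + 1) = d + 1 := by omega
    have h2 : j + d + 1 - j = d + 1 := by omega
    have h3 : j + d + 1 - (j + 1) = d := by omega
    simp only [binomPMF, h1, h2, h3, Nat.choose_succ_succ (j + d + 1) j]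
    push_cast
    ring
  · rw [binomPMF_eq_zero_of_lt x (show m < j + 1 by omega)]
    rcases h.eq_or_lt with rfl | h
    · simp [binomPMF, pow_succ']
    · rw [binomPMF_eq_zero_of_lt x h, binomPMF_eq_zero_of_lt x (show m + 1 < j + 1 by omega)]
      ring

/-- Conditioning a binomial expectation on one of the trials. -/
lemma sum_binomPMF_succ_mul (m : ℕ) (x : ℝ) (g : ℕ → ℝ) :
    ∑ j ∈ range (m + 2), binomPMF (m + 1) x j * g j =
      x * ∑ j ∈ range (m + 1), binomPMF m x j * g (j + 1) +
        (1 - x) * ∑ j ∈ range (m + 1), binomPMF m x j * g j := by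
  have h : ∑ j ∈ range (m + 1), binomPMF m x j * g j =
      ∑ j ∈ range (m + 1), binomPMF m x (j + 1) * g (j + 1) + binomPMF m x 0 * g 0 := by
    rw [← sum_range_succ' (fun j => binomPMF m x j * g j), sum_range_succ _ (m + 1),
      binomPMF_eq_zero_of_lt x (Nat.lt_succ_self m)]
    ring
  rw [sum_range_succ', binomPMF_succ_zero, h, mul_add, ← add_assoc, mul_sum, mul_sum,
    ← sum_add_distrib]
  congr 1
  · refine sum_congr rfl fun j _ => ?_
    rw [binomPMF_succ_succ]
    ring
  · ring

lemma sum_binomPMF (m : ℕ) (x : ℝ) : ∑ j ∈ range (m + 1), binomPMF m x j = 1 := by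
  induction m with
  | zero => simp [binomPMF]
  | succ m ih =>
    have := sum_binomPMF_succ_mul m x (fun _ => 1)
    simp only [mul_one] at this
    rw [this, ih]
    ring

lemma sum_binomPMF_mul_sub (m : ℕ) (x c : ℝ) :
    ∑ j ∈ range (m + 1), binomPMF m x j * ((j : ℝ) - c) = m * x - c := by
  induction m generalizing c with
  | zero => simp [binomPMF]
  | succ m ih =>
    rw [sum_binomPMF_succ_mul m x (fun j => (j : ℝ) - c), ih c]
    have h : ∀ j : ℕ, ((j + 1 : ℕ) : ℝ) - c = j - (c - 1) := fun j => by push_cast; ring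
    simp only [h, ih]
    push_cast
    ring

lemma sum_binomPMF_mul_sub_sq (m : ℕ) (x c : ℝ) :
    ∑ j ∈ range (m + 1), binomPMF m x j * ((j : ℝ) - c) ^ 2 =
      m * (x * (1 - x)) + (m * x - c) ^ 2 := by
  induction m generalizing c with
  | zero => simp [binomPMF]
  | succ m ih =>
    rw [sum_binomPMF_succ_mul m x (fun j => ((j : ℝ) - c) ^ 2), ih c]
    have h : ∀ j : ℕ, ((j + 1 : ℕ) : ℝ) - c = j - (c - 1) := fun j => by push_cast; ring
    simp only [h, ih]
    push_cast
    ring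

/-- Thinning `Bin(m,x)` by independent coins of bias `t` gives `Bin(m,x*t)`. -/
lemma sum_binomPMF_mul_binomPMF (m : ℕ) (x t : ℝ) (j : ℕ) :
    ∑ i ∈ range (m + 1), binomPMF m x i * binomPMF i t j = binomPMF m (x * t) j := by
  induction m generalizing j with
  | zero => cases j <;> simp [binomPMF]
  | succ m ih =>
    rw [sum_binomPMF_succ_mul m x (fun i => binomPMF i t j)]
    cases j with
    | zero =>
      have h : ∀ i, binomPMF m x i * binomPMF (i + 1) t 0 =
          (1 - t) * (binomPMF m x i * binomPMF i t 0) := fun i => by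
        rw [binomPMF_succ_zero]; ring
      simp only [h]
      rw [← mul_sum, ih, binomPMF_succ_zero]
      ring
    | succ j =>
      have h : ∀ i, binomPMF m x i * binomPMF (i + 1) t (j + 1) =
          t * (binomPMF m x i * binomPMF i t j) +
            (1 - t) * (binomPMF m x i * binomPMF i t (j + 1)) := fun i => by
        rw [binomPMF_succ_succ]; ring
      simp only [h]
      rw [sum_add_distrib, ← mul_sum, ← mul_sum, ih, ih, binomPMF_succ_succ]
      ring

lemma sum_range_binomPMF_le_one (t : ℝ) {i m : ℕ} (h : i ≤ m) :
    ∑ j ∈ range (m + 1), binomPMF i t j ≤ 1 := by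
  rw [← sum_binomPMF i t]
  refine (sum_subset (range_mono (by omega)) fun j _ hj => ?_).ge
  exact binomPMF_eq_zero_of_lt t (by simpa using hj)

lemma binomL1_nonneg (m : ℕ) (x y : ℝ) : 0 ≤ binomL1 m x y :=
  sum_nonneg fun _ _ => abs_nonneg _

lemma binomL1_self (m : ℕ) (x : ℝ) : binomL1 m x x = 0 := by
  simp [binomL1]

lemma binomL1_comm (m : ℕ) (x y : ℝ) : binomL1 m x y = binomL1 m y x :=
  sum_congr rfl fun _ _ => abs_sub_comm _ _

lemma binomL1_triangle (m : ℕ) (x y z : ℝ) :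
    binomL1 m x z ≤ binomL1 m x y + binomL1 m y z := by
  unfold binomL1
  rw [← sum_add_distrib]
  exact sum_le_sum fun j _ => abs_sub_le _ _ _

lemma binomL1_one_sub (m : ℕ) (x y : ℝ) : binomL1 m (1 - x) (1 - y) = binomL1 m x y := by
  unfold binomL1
  rw [← sum_range_reflect]
  refine sum_congr rfl fun j hj => ?_
  have hj : j ≤ m := by simpa [Nat.lt_succ_iff] using hj
  have key : ∀ z, binomPMF m (1 - z) (m + 1 - 1 - j) = binomPMF m z j := fun z => by
    simp only [binomPMF, Nat.add_sub_cancel, Nat.choose_symm hj, Nat.sub_sub_self hj,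
      sub_sub_cancel]
    ring
  rw [key, key]

lemma binomL1_le_two (m : ℕ) {x y : ℝ} (hx0 : 0 ≤ x) (hx1 : x ≤ 1) (hy0 : 0 ≤ y) (hy1 : y ≤ 1) :
    binomL1 m x y ≤ 2 := by
  have h : binomL1 m x y ≤ ∑ j ∈ range (m + 1), (binomPMF m x j + binomPMF m y j) := by
    refine sum_le_sum fun j _ => ?_
    have h1 := binomPMF_nonneg hx0 hx1 m j
    have h2 := binomPMF_nonneg hy0 hy1 m j
    rw [abs_le]
    constructor <;> linarith
  rw [sum_add_distrib, sum_binomPMF, sum_binomPMF] at h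
  linarith

lemma binomL1_mul_right_le (m : ℕ) (x y : ℝ) {t : ℝ} (ht0 : 0 ≤ t) (ht1 : t ≤ 1) :
    binomL1 m (x * t) (y * t) ≤ binomL1 m x y := by
  calc binomL1 m (x * t) (y * t)
      = ∑ j ∈ range (m + 1),
          |∑ i ∈ range (m + 1), (binomPMF m x i - binomPMF m y i) * binomPMF i t j| := by
        refine sum_congr rfl fun j _ => ?_
        rw [← sum_binomPMF_mul_binomPMF, ← sum_binomPMF_mul_binomPMF, ← sum_sub_distrib]
        simp only [sub_mul]
    _ ≤ ∑ j ∈ range (m + 1), ∑ i ∈ range (m + 1),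
          |binomPMF m x i - binomPMF m y i| * binomPMF i t j := by
        refine sum_le_sum fun j _ => (abs_sum_le_sum_abs _ _).trans (sum_le_sum fun i _ => ?_)
        rw [abs_mul, abs_of_nonneg (binomPMF_nonneg ht0 ht1 i j)]
    _ = ∑ i ∈ range (m + 1),
          |binomPMF m x i - binomPMF m y i| * ∑ j ∈ range (m + 1), binomPMF i t j := by
        rw [sum_comm]
        simp only [mul_sum]
    _ ≤ binomL1 m x y := by
        refine sum_le_sum fun i hi => mul_le_of_le_one_right (abs_nonneg _) ?_
        exact sum_range_binomPMF_le_one t (by simpa [Nat.lt_succ_iff] using hi)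

/-- Consecutive terms of a geometric progression of parameters get closer and closer. -/
lemma binomL1_mul_pow_le (m : ℕ) (b : ℝ) {t : ℝ} (ht0 : 0 ≤ t) (ht1 : t ≤ 1) (k : ℕ) :
    binomL1 m b (b * t ^ k) ≤ k * binomL1 m b (b * t) := by
  induction k with
  | zero => simp [binomL1_self]
  | succ k ih =>
    have h := binomL1_mul_right_le m b (b * t) (pow_nonneg ht0 k) (pow_le_one₀ ht0 ht1)
    have h2 := binomL1_triangle m b (b * t ^ k) (b * t ^ (k + 1))
    rw [show b * t * t ^ k = b * t ^ (k + 1) by ring] at h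
    push_cast
    linarith

/-- A second-moment lower bound: well separated means force a large `ℓ1` distance. -/
lemma mul_sq_sub_le_binomL1_mul {m : ℕ} (hm : 1 ≤ m) {x y : ℝ} (hx0 : 0 ≤ x) (hx1 : x ≤ 1)
    (hy0 : 0 ≤ y) (hy1 : y ≤ 1) :
    m * (x - y) ^ 2 ≤
      binomL1 m x y * (x * (1 - x) + y * (1 - y) + m * (x - y) ^ 2 / 2) := by
  have hm0 : (0 : ℝ) < m := by exact_mod_cast hm
  set c : ℝ := m * (x + y) / 2 with hc
  have hmean : ∑ j ∈ range (m + 1), (binomPMF m x j - binomPMF m y j) * ((j : ℝ) - c) =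
      m * (x - y) := by
    simp only [sub_mul (binomPMF m x _), sum_sub_distrib, sum_binomPMF_mul_sub]
    ring
  have hsq : ∑ j ∈ range (m + 1), |binomPMF m x j - binomPMF m y j| * ((j : ℝ) - c) ^ 2 ≤
      m * (x * (1 - x) + y * (1 - y) + m * (x - y) ^ 2 / 2) := by
    have : ∑ j ∈ range (m + 1), |binomPMF m x j - binomPMF m y j| * ((j : ℝ) - c) ^ 2 ≤
        ∑ j ∈ range (m + 1), (binomPMF m x j + binomPMF m y j) * ((j : ℝ) - c) ^ 2 := by
      refine sum_le_sum fun j _ => mul_le_mul_of_nonneg_right ?_ (sq_nonneg _)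
      have h1 := binomPMF_nonneg hx0 hx1 m j
      have h2 := binomPMF_nonneg hy0 hy1 m j
      rw [abs_le]
      constructor <;> linarith
    refine this.trans (le_of_eq ?_)
    simp only [add_mul, sum_add_distrib, sum_binomPMF_mul_sub_sq]
    rw [hc]
    ring
  have hcs : (m * (x - y)) ^ 2 ≤ binomL1 m x y *
      ∑ j ∈ range (m + 1), |binomPMF m x j - binomPMF m y j| * ((j : ℝ) - c) ^ 2 := by
    rw [← hmean]
    refine sum_sq_le_sum_mul_sum_of_sq_le_mul _ (fun _ _ => abs_nonneg _)
      (fun _ _ => mul_nonneg (abs_nonneg _) (sq_nonneg _)) fun j _ => ?_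
    rw [mul_pow, ← sq_abs (binomPMF m x j - _)]
    exact le_of_eq (by ring)
  have h := hcs.trans (mul_le_mul_of_nonneg_left hsq (binomL1_nonneg m x y))
  refine le_of_mul_le_mul_left ?_ hm0
  linarith

lemma one_sub_pow_mul_le_one {x : ℝ} (hx0 : 0 ≤ x) (hx1 : x ≤ 1) (k : ℕ) :
    (1 - x) ^ k * (1 + k * x) ≤ 1 := by
  calc (1 - x) ^ k * (1 + k * x) ≤ (1 - x) ^ k * (1 + x) ^ k := by
        have : 0 ≤ 1 - x := by linarith
        gcongr
        exact one_add_mul_le_pow (by linarith) k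
    _ = (1 - x ^ 2) ^ k := by rw [← mul_pow]; ring
    _ ≤ 1 := pow_le_one₀ (by nlinarith) (by nlinarith)

lemma one_le_binomL1_of_separated {m : ℕ} (hm : 1 ≤ m) {b c M : ℝ} (hb0 : 0 ≤ b) (hb1 : b ≤ 1)
    (hc0 : 0 ≤ c) (hc1 : c ≤ 1) (hcb : c < b) (hM0 : 0 ≤ M) (hmM : 1 ≤ m * M)
    (hsep : M / 4 ≤ b - c) (hV : b * (1 - b) + c * (1 - c) ≤ 2 * (m * M ^ 2) + 3 * (b - c)) :
    1 ≤ 45 * binomL1 m b c := by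
  have hm0 : (0 : ℝ) < m := by exact_mod_cast hm
  have h := mul_sq_sub_le_binomL1_mul hm hb0 hb1 hc0 hc1
  set Δ := b - c
  have hΔ0 : 0 < Δ := sub_pos.mpr hcb
  have hM2 : M ^ 2 ≤ 16 * Δ ^ 2 := by nlinarith
  have hΔm : Δ ≤ 4 * (m * Δ ^ 2) := by
    have h1 : 1 ≤ m * (4 * Δ) := hmM.trans (by gcongr; linarith)
    nlinarith
  have hden : b * (1 - b) + c * (1 - c) + m * Δ ^ 2 / 2 ≤ 45 * (m * Δ ^ 2) := by
    have h1 : m * M ^ 2 ≤ m * (16 * Δ ^ 2) := by gcongr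
    linarith
  have h2 := h.trans (mul_le_mul_of_nonneg_left hden (binomL1_nonneg m b c))
  have h3 : 0 < m * Δ ^ 2 := by positivity
  refine le_of_mul_le_mul_left ?_ h3
  linarith

lemma min_le_binomL1_of_half_le {m : ℕ} (hm : 1 ≤ m) {a b M : ℝ} (ha : 0 ≤ a) (hab : a < b)
    (hb : b ≤ 1) (hb2 : 1 / 2 ≤ b) (hM1 : M ≤ 1) (hmM : 1 ≤ m * M)
    (hV : b * (1 - b) ≤ m * M ^ 2 + (b - a)) :
    (1 / 350 : ℝ) * min ((b - a) / M) 1 ≤ binomL1 m b a := by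
  have hm0 : (0 : ℝ) < m := by exact_mod_cast hm
  have hM0 : 0 < M := by
    by_contra! h
    nlinarith
  have hb0 : 0 < b := by linarith
  have hd : 0 < b - a := by linarith
  set t := a / b with ht
  have hbt : b * t = a := by rw [ht]; field_simp
  have ht0 : 0 ≤ t := by positivity
  have ht1 : t ≤ 1 := by rw [ht, div_le_one hb0]; exact hab.le
  set k := ⌈M / (2 * (b - a))⌉₊ with hk
  have hpos : 0 < M / (2 * (b - a)) := by positivity
  have hk1 : 1 ≤ k := Nat.one_le_iff_ne_zero.mpr (Nat.ceil_pos.mpr hpos).ne'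
  have hklo : M ≤ 2 * (k * (b - a)) := by
    have := Nat.le_ceil (M / (2 * (b - a)))
    rw [div_le_iff₀ (by positivity)] at this
    linarith
  have hkhi : (k : ℝ) < M / (2 * (b - a)) + 1 := Nat.ceil_lt_add_one hpos.le
  set c := b * t ^ k with hc
  have htk0 : 0 ≤ t ^ k := pow_nonneg ht0 k
  have hc0 : 0 ≤ c := by positivity
  have hca : c ≤ a := by
    rw [← hbt, hc]
    gcongr
    exact pow_le_of_le_one ht0 ht1 (by omega)
  have hcM : M / 4 ≤ b - c := by
    have h := one_sub_pow_mul_le_one (x := 1 - t) (by linarith) (by linarith) k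
    rw [sub_sub_cancel] at h
    have h1 : c * (b + k * (b - a)) ≤ b ^ 2 := by
      calc c * (b + k * (b - a)) = b ^ 2 * (t ^ k * (1 + k * (1 - t))) := by rw [hc, ← hbt]; ring
        _ ≤ b ^ 2 * 1 := by gcongr
        _ = b ^ 2 := mul_one _
    have h2 : c * (b + M / 2) ≤ b ^ 2 :=
      le_trans (by gcongr; linarith) h1
    by_contra! h3
    have h4 : (b - M / 4) * (b + M / 2) < c * (b + M / 2) := by
      gcongr
      linarith
    nlinarith
  have hcb : c * (1 - c) ≤ b * (1 - b) + (b - c) := by nlinarith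
  have hfar : 1 ≤ 45 * binomL1 m b c :=
    one_le_binomL1_of_separated hm hb0.le hb hc0 (by linarith) (by linarith) hM0.le hmM hcM
      (by linarith)
  have hchain := binomL1_mul_pow_le m b ht0 ht1 k
  rw [hbt, ← hc] at hchain
  set T := min ((b - a) / M) 1 with hT
  have hT1 : T ≤ 1 := min_le_right _ _
  have hT0 : 0 ≤ T := by positivity
  have hTM : T * (M / (2 * (b - a))) ≤ 1 / 2 := by
    calc T * (M / (2 * (b - a))) ≤ (b - a) / M * (M / (2 * (b - a))) := by
          gcongr
          exact min_le_left _ _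
      _ = 1 / 2 := by field_simp
  have hTk : T * k ≤ 3 / 2 := by nlinarith
  have hL := binomL1_nonneg m b a
  have h1 : T ≤ T * (45 * (k * binomL1 m b a)) :=
    le_mul_of_one_le_right hT0 (by linarith)
  have h2 := mul_le_mul_of_nonneg_right hTk hL
  linarith

lemma binomL1_le_mul_abs_sub (m : ℕ) {x y : ℝ} (hx0 : 0 ≤ x) (hx1 : x ≤ 1) (hy0 : 0 ≤ y)
    (hy1 : y ≤ 1) : binomL1 m x y ≤ 2 * (m * |x - y|) := by
  induction m with
  | zero => simp [binomL1, binomPMF]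
  | succ m ih =>
    set D : ℕ → ℝ := fun j => |binomPMF m x j - binomPMF m y j| with hD
    have hD' : ∀ j, D j = |binomPMF m x j - binomPMF m y j| := fun _ => rfl
    have hx' : 0 ≤ 1 - x := by linarith
    have hshift : ∀ f : ℕ → ℝ, f (m + 1) = 0 →
        ∑ j ∈ range (m + 1), f (j + 1) + f 0 = ∑ j ∈ range (m + 1), f j := fun f hf => by
      rw [← sum_range_succ' f, sum_range_succ _ (m + 1), hf, add_zero]
    have hlast : ∀ z, binomPMF m z (m + 1) = 0 := fun z =>
      binomPMF_eq_zero_of_lt z (Nat.lt_succ_self m)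
    have hzero : |binomPMF (m + 1) x 0 - binomPMF (m + 1) y 0| ≤
        (1 - x) * D 0 + |x - y| * binomPMF m y 0 := by
      have h : binomPMF (m + 1) x 0 - binomPMF (m + 1) y 0 =
          (1 - x) * (binomPMF m x 0 - binomPMF m y 0) - (x - y) * binomPMF m y 0 := by
        simp only [binomPMF_succ_zero]
        ring
      rw [h]
      refine (abs_sub _ _).trans (le_of_eq ?_)
      rw [abs_mul, abs_mul, abs_of_nonneg hx', abs_of_nonneg (binomPMF_nonneg hy0 hy1 m 0)]
    have hsucc : ∀ j, |binomPMF (m + 1) x (j + 1) - binomPMF (m + 1) y (j + 1)| ≤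
        (x * D j + |x - y| * binomPMF m y j) +
          ((1 - x) * D (j + 1) + |x - y| * binomPMF m y (j + 1)) := fun j => by
      have h : binomPMF (m + 1) x (j + 1) - binomPMF (m + 1) y (j + 1) =
          (x * (binomPMF m x j - binomPMF m y j) + (x - y) * binomPMF m y j) +
          ((1 - x) * (binomPMF m x (j + 1) - binomPMF m y (j + 1)) -
            (x - y) * binomPMF m y (j + 1)) := by
        simp only [binomPMF_succ_succ]
        ring
      rw [h]
      refine (abs_add_le _ _).trans
        ((add_le_add (abs_add_le _ _) (abs_sub _ _)).trans (le_of_eq ?_))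
      simp only [abs_mul, abs_of_nonneg hx', abs_of_nonneg hx0,
        abs_of_nonneg (binomPMF_nonneg hy0 hy1 m _), hD']
    have hS := sum_binomPMF m y
    have hsum : binomL1 (m + 1) x y ≤ binomL1 m x y + 2 * |x - y| := by
      calc binomL1 (m + 1) x y
          ≤ ∑ j ∈ range (m + 1), ((x * D j + |x - y| * binomPMF m y j) +
              ((1 - x) * D (j + 1) + |x - y| * binomPMF m y (j + 1))) +
              ((1 - x) * D 0 + |x - y| * binomPMF m y 0) := by
            unfold binomL1
            rw [sum_range_succ']
            exact add_le_add (sum_le_sum fun j _ => hsucc j) hzero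
        _ = ∑ j ∈ range (m + 1), (x * D j + |x - y| * binomPMF m y j) +
              ∑ j ∈ range (m + 1), ((1 - x) * D j + |x - y| * binomPMF m y j) := by
            rw [sum_add_distrib, add_assoc,
              hshift (fun j => (1 - x) * D j + |x - y| * binomPMF m y j) (by simp [hD, hlast])]
        _ = ∑ j ∈ range (m + 1), D j + 2 * |x - y| * ∑ j ∈ range (m + 1), binomPMF m y j := by
            simp only [sum_add_distrib, ← mul_sum]
            ring
        _ = binomL1 m x y + 2 * |x - y| := by rw [hS, mul_one, hD]; rfl
    push_cast
    linarith

/-- The chi-squared divergence between binomial distributions. -/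
lemma sum_sq_sub_binomPMF_div (m : ℕ) {p q : ℝ} (hp0 : 0 < p) (hp1 : p < 1) :
    ∑ j ∈ range (m + 1), (binomPMF m p j - binomPMF m q j) ^ 2 / binomPMF m p j =
      (1 + (p - q) ^ 2 / (p * (1 - p))) ^ m - 1 := by
  have hp' : 0 < 1 - p := by linarith
  have hbase : 1 + (p - q) ^ 2 / (p * (1 - p)) = q ^ 2 / p + (1 - q) ^ 2 / (1 - p) := by
    field_simp
    ring
  have hterm : ∀ j ∈ range (m + 1),
      (binomPMF m p j - binomPMF m q j) ^ 2 / binomPMF m p j =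
        binomPMF m p j - 2 * binomPMF m q j +
          (q ^ 2 / p) ^ j * ((1 - q) ^ 2 / (1 - p)) ^ (m - j) * (m.choose j : ℝ) := by
    intro j hj
    have hj : j ≤ m := by simpa [Nat.lt_succ_iff] using hj
    have hch : (0 : ℝ) < m.choose j := by exact_mod_cast Nat.choose_pos hj
    simp only [binomPMF, div_pow]
    generalize 1 - q = q'
    field_simp
    ring
  rw [hbase, add_pow, sum_congr rfl hterm, sum_add_distrib, sum_sub_distrib, ← mul_sum,
    sum_binomPMF, sum_binomPMF]
  ring

lemma binomL1_le_sqrt_mul_abs_sub_div (m : ℕ) {p q : ℝ} (hp0 : 0 < p) (hp1 : p < 1)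
    (hq0 : 0 ≤ q) (hq1 : q ≤ 1) :
    binomL1 m p q ≤ 2 * (√m * |p - q| / √(p * (1 - p))) := by
  have hp' : 0 < 1 - p := by linarith
  have hv : 0 < p * (1 - p) := by positivity
  set r := √m * |p - q| / √(p * (1 - p)) with hr
  have hr0 : 0 ≤ r := by positivity
  rcases le_or_gt 1 r with h1 | h1
  · have := binomL1_le_two m hp0.le hp1.le hq0 hq1
    linarith
  have hr2 : r ^ 2 = m * ((p - q) ^ 2 / (p * (1 - p))) := by
    rw [hr, div_pow, mul_pow, Real.sq_sqrt (by positivity), Real.sq_sqrt hv.le, sq_abs]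
    ring
  have hexp : (1 + (p - q) ^ 2 / (p * (1 - p))) ^ m ≤ Real.exp (r ^ 2) := by
    rw [hr2, Real.exp_nat_mul]
    gcongr
    rw [add_comm]
    exact Real.add_one_le_exp _
  have hexp2 : Real.exp (r ^ 2) ≤ 1 + r ^ 2 + (r ^ 2) ^ 2 := by
    have h := Real.abs_exp_sub_one_sub_id_le (x := r ^ 2)
      (by rw [abs_of_nonneg (by positivity)]; nlinarith)
    linarith [(abs_le.mp h).2]
  have hpos : ∀ j ∈ range (m + 1), 0 < binomPMF m p j := fun j hj => by
    have hj : j ≤ m := by simpa [Nat.lt_succ_iff] using hj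
    have hch : (0 : ℝ) < m.choose j := by exact_mod_cast Nat.choose_pos hj
    unfold binomPMF
    positivity
  have hcs : binomL1 m p q ^ 2 ≤ (∑ j ∈ range (m + 1), binomPMF m p j) *
      ∑ j ∈ range (m + 1), (binomPMF m p j - binomPMF m q j) ^ 2 / binomPMF m p j := by
    refine sum_sq_le_sum_mul_sum_of_sq_le_mul _ (fun j hj => (hpos j hj).le)
      (fun j hj => div_nonneg (sq_nonneg _) (hpos j hj).le) fun j hj => ?_
    rw [sq_abs, mul_div_cancel₀ _ (hpos j hj).ne']
  rw [sum_binomPMF, one_mul, sum_sq_sub_binomPMF_div m hp0 hp1] at hcs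
  refine abs_le_of_sq_le_sq' ?_ (by positivity) |>.2
  nlinarith [mul_nonneg (sq_nonneg r) (by nlinarith : 0 ≤ 1 - r ^ 2)]

lemma min_le_binomL1 {m : ℕ} (hm : 1 ≤ m) {a b M v : ℝ} (ha : 0 ≤ a) (hab : a < b) (hb : b ≤ 1)
    (hM1 : M ≤ 1) (hmM : 1 ≤ m * M) (hv : v ≤ m * M ^ 2)
    (hav : a * (1 - a) ≤ v + (b - a)) (hbv : b * (1 - b) ≤ v + (b - a)) :
    (1 / 350 : ℝ) * min ((b - a) / M) 1 ≤ binomL1 m b a := by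
  rcases le_or_gt (1 / 2) b with h | h
  · exact min_le_binomL1_of_half_le hm ha hab hb h hM1 hmM (by linarith)
  · have := min_le_binomL1_of_half_le hm (a := 1 - b) (b := 1 - a) (M := M) (by linarith)
      (by linarith) (by linarith) (by linarith) hM1 hmM (by linarith)
    rwa [binomL1_one_sub, binomL1_comm, show 1 - a - (1 - b) = b - a by ring] at this

/-- two-sided bound on the ℓ1 distance between binomial distributions. -/
theorem stmt5 (m : ℕ) (hm : 1 ≤ m) (p q : ℝ) (hp0 : 0 < p) (hp1 : p < 1)
    (hq0 : 0 ≤ q) (hq1 : q ≤ 1) :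
    (1 / 350 : ℝ) * min ((m : ℝ) * |p - q|)
        (min (Real.sqrt m * |p - q| / Real.sqrt (p * (1 - p))) 1) ≤ binomL1 m p q ∧
    binomL1 m p q ≤ 2 * min ((m : ℝ) * |p - q|)
        (min (Real.sqrt m * |p - q| / Real.sqrt (p * (1 - p))) 1) := by
  have hm0 : (0 : ℝ) < m := by exact_mod_cast hm
  have hm1 : (1 : ℝ) ≤ m := by exact_mod_cast hm
  have hv : 0 < p * (1 - p) := mul_pos hp0 (by linarith)
  constructor
  · set s := √(p * (1 - p)) with hs
    have hs0 : 0 < s := Real.sqrt_pos.mpr hv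
    have hs2 : s ^ 2 = p * (1 - p) := Real.sq_sqrt hv.le
    have hr0 : 0 < √(m : ℝ) := Real.sqrt_pos.mpr hm0
    have hr1 : 1 ≤ √(m : ℝ) := Real.one_le_sqrt.mpr hm1
    have hr2 : √(m : ℝ) ^ 2 = m := Real.sq_sqrt hm0.le
    set M := max (1 / (m : ℝ)) (s / √m) with hM
    have hM1 : M ≤ 1 := by
      refine max_le ((div_le_one hm0).mpr hm1) ((div_le_one hr0).mpr ?_)
      nlinarith
    have hmM : 1 ≤ m * M := by
      calc (1 : ℝ) = m * (1 / m) := by field_simp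
        _ ≤ m * M := by gcongr; exact le_max_left _ _
    have hvM : p * (1 - p) ≤ m * M ^ 2 := by
      calc p * (1 - p) = m * (s / √m) ^ 2 := by rw [div_pow, hr2, hs2]; field_simp
        _ ≤ m * M ^ 2 := by gcongr; exact le_max_right _ _
    have hmin : min (m * |p - q|) (min (√m * |p - q| / s) 1) ≤ min (|p - q| / M) 1 := by
      refine le_min ?_ ((min_le_right _ _).trans (min_le_right _ _))
      rcases max_choice (1 / (m : ℝ)) (s / √m) with h | h
      · refine (min_le_left _ _).trans (le_of_eq ?_)
        rw [hM, h]
        field_simp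
      · refine (min_le_right _ _).trans ((min_le_left _ _).trans (le_of_eq ?_))
        rw [hM, h]
        field_simp
    refine (mul_le_mul_of_nonneg_left hmin (by norm_num)).trans ?_
    rcases lt_trichotomy p q with h | h | h
    · rw [abs_of_neg (by linarith), neg_sub, binomL1_comm]
      exact min_le_binomL1 hm hp0.le h hq1 hM1 hmM hvM (by linarith) (by nlinarith)
    · simp [h, binomL1_self]
    · rw [abs_of_pos (by linarith)]
      exact min_le_binomL1 hm hq0 h hp1.le hM1 hmM hvM (by nlinarith) (by linarith)
  · have h1 := binomL1_le_mul_abs_sub m hp0.le hp1.le hq0 hq1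
    have h2 := binomL1_le_sqrt_mul_abs_sub_div m hp0 hp1 hq0 hq1
    have h3 := binomL1_le_two m hp0.le hp1.le hq0 hq1
    rw [← div_le_iff₀' two_pos] at h1 h2 ⊢
    exact le_min h1 (le_min h2 (by linarith))
end

section
/- For all positive integers m and all p, q ∈ [0,1] with p ∈ (0,1), ℓ1(Bin(m,p), Bin(m,q)) ≥ (1/350) · min( m|p−q|, √m |p−q| / √(p(1−p)), 1 ). -/
/-- The probability generating function of `Bin(m,p)`. -/
theorem sum_binomPMF_mul_pow (m : ℕ) (p : ℝ) (z : ℂ) :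
    ∑ j ∈ Finset.range (m + 1), (binomPMF m p j : ℂ) * z ^ j = (p * z + (1 - p)) ^ m := by
  rw [add_pow]
  refine Finset.sum_congr rfl fun j _ => ?_
  simp only [binomPMF]
  push_cast
  ring

/-- The ℓ1 distance dominates the distance of the generating functions on the unit circle. -/
theorem norm_pow_sub_pow_le_binomL1 (m : ℕ) (p q : ℝ) {z : ℂ} (hz : ‖z‖ = 1) :
    ‖((p : ℂ) * z + (1 - p)) ^ m - (q * z + (1 - q)) ^ m‖ ≤ binomL1 m p q := by
  rw [← sum_binomPMF_mul_pow, ← sum_binomPMF_mul_pow, ← Finset.sum_sub_distrib]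
  refine (norm_sum_le _ _).trans (Finset.sum_le_sum fun j _ => ?_)
  rw [← sub_mul, norm_mul, norm_pow, hz, one_pow, mul_one, ← Complex.ofReal_sub,
    Complex.norm_real, Real.norm_eq_abs]

/-- Second-order estimate for `(1 + w) ^ n` when `n * ‖w‖` is small. -/
theorem norm_one_add_pow_sub_le (w : ℂ) (n : ℕ) (h : n * ‖w‖ ≤ 1 / 2) :
    ‖(1 + w) ^ n - 1 - n * w‖ ≤ (n * ‖w‖) ^ 2 := by
  induction n with
  | zero => simp
  | succ n ih =>
    push_cast at h ⊢
    have hw := norm_nonneg w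
    have hn : (0 : ℝ) ≤ n := n.cast_nonneg
    have hnw : n * ‖w‖ ≤ 1 / 2 := by nlinarith
    have key : (1 + w) ^ (n + 1) - 1 - ((n : ℂ) + 1) * w =
        (1 + w) * ((1 + w) ^ n - 1 - n * w) + n * w ^ 2 := by ring
    have h1 : ‖1 + w‖ ≤ 1 + ‖w‖ := by simpa using norm_add_le (1 : ℂ) w
    calc ‖(1 + w) ^ (n + 1) - 1 - ((n : ℂ) + 1) * w‖
        ≤ ‖1 + w‖ * ‖(1 + w) ^ n - 1 - n * w‖ + n * ‖w‖ ^ 2 := by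
          rw [key]
          refine (norm_add_le _ _).trans ?_
          simp
      _ ≤ (1 + ‖w‖) * (n * ‖w‖) ^ 2 + n * ‖w‖ ^ 2 := by
          gcongr
          exact ih hnw
      _ ≤ ((n + 1) * ‖w‖) ^ 2 := by
          have : n * ‖w‖ * (n * ‖w‖ ^ 2) ≤ 1 / 2 * (n * ‖w‖ ^ 2) := by gcongr
          nlinarith [sq_nonneg ‖w‖, mul_nonneg hn (sq_nonneg ‖w‖)]

theorem half_mul_norm_le_norm_one_add_pow_sub_one (w : ℂ) (n : ℕ) (h : n * ‖w‖ ≤ 1 / 2) :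
    n * ‖w‖ / 2 ≤ ‖(1 + w) ^ n - 1‖ := by
  have h1 := norm_one_add_pow_sub_le w n h
  have h2 := norm_sub_norm_le ((n : ℂ) * w) (-((1 + w) ^ n - 1 - n * w))
  rw [norm_neg, sub_neg_eq_add, add_sub_cancel, norm_mul, Complex.norm_natCast] at h2
  have h0 : 0 ≤ n * ‖w‖ := by positivity
  nlinarith

theorem exists_norm_eq_one_norm_sub_one_eq {t : ℝ} (h0 : 0 ≤ t) (h2 : t ≤ 2) :
    ∃ z : ℂ, ‖z‖ = 1 ∧ ‖z - 1‖ = t ∧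
      ∀ p : ℝ, ‖(p : ℂ) * z + (1 - p)‖ ^ 2 = 1 - p * (1 - p) * t ^ 2 := by
  have hs : √(1 - t ^ 2 / 4) ^ 2 = 1 - t ^ 2 / 4 := Real.sq_sqrt (by nlinarith)
  refine ⟨⟨1 - t ^ 2 / 2, t * √(1 - t ^ 2 / 4)⟩, ?_, ?_, fun p => ?_⟩
  · rw [← sq_eq_sq₀ (norm_nonneg _) zero_le_one, Complex.sq_norm, Complex.normSq_apply]
    linear_combination t ^ 2 * hs
  · rw [← sq_eq_sq₀ (norm_nonneg _) h0, Complex.sq_norm, Complex.normSq_apply]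
    simp
    linear_combination t ^ 2 * hs
  · rw [Complex.sq_norm, Complex.normSq_apply]
    simp
    linear_combination p ^ 2 * t ^ 2 * hs

/-- Lower bound by a test point at distance `t` from `1` on the unit circle. -/
theorem mul_le_binomL1 (m : ℕ) {p q t : ℝ} (hp0 : 0 < p) (hp1 : p < 1) (h0 : 0 ≤ t)
    (h1 : t ≤ 1 / 4) (hvar : m * (p * (1 - p)) * t ^ 2 ≤ 1 / 16)
    (hsep : m * |p - q| * t ≤ 1 / 4) :
    15 / 32 * (m * |p - q| * t) ≤ binomL1 m p q := by
  obtain ⟨z, hz, hz1, hza⟩ := exists_norm_eq_one_norm_sub_one_eq h0 (h1.trans (by norm_num))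
  refine le_trans ?_ (norm_pow_sub_pow_le_binomL1 m p q hz)
  have ha2 := hza p
  set a : ℂ := (p : ℂ) * z + (1 - p) with ha
  have hpp : 0 ≤ p * (1 - p) := mul_nonneg hp0.le (by linarith)
  have hpp' : p * (1 - p) ≤ 1 := by nlinarith
  have htt : t ^ 2 ≤ 1 / 16 := by nlinarith
  have hptt : p * (1 - p) * t ^ 2 ≤ 1 / 16 := by nlinarith [sq_nonneg t]
  have hptt0 : 0 ≤ p * (1 - p) * t ^ 2 := by positivity
  have hale : ‖a‖ ≤ 1 := by nlinarith [norm_nonneg a]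
  have hage : 1 / 2 ≤ ‖a‖ := by nlinarith [norm_nonneg a]
  have hapos : 0 < ‖a‖ := by linarith
  have hane : a ≠ 0 := norm_pos_iff.mp hapos
  have hpow : 15 / 16 ≤ ‖a‖ ^ m := by
    have hb := one_add_mul_le_pow (a := -(p * (1 - p) * t ^ 2)) (by linarith) m
    have hsq : (‖a‖ ^ 2) ^ m ≤ ‖a‖ ^ m := by
      gcongr
      nlinarith
    rw [ha2, sub_eq_add_neg] at hsq
    linarith
  set w : ℂ := (q - p) * (z - 1) / a with hw
  have hqz : (q : ℂ) * z + (1 - q) = a * (1 + w) := by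
    rw [hw, mul_add, mul_div_cancel₀ _ hane, ha]
    ring
  have hwn : ‖w‖ = |p - q| * t / ‖a‖ := by
    rw [hw, norm_div, norm_mul, hz1, ← Complex.ofReal_sub, Complex.norm_real, Real.norm_eq_abs,
      abs_sub_comm]
  have hmw : m * ‖w‖ = m * |p - q| * t / ‖a‖ := by rw [hwn]; ring
  have hD : 0 ≤ m * |p - q| * t := by positivity
  have hmw1 : m * ‖w‖ ≤ 1 / 2 := by
    rw [hmw, div_le_iff₀ hapos]
    linarith
  have hmw2 : m * |p - q| * t ≤ m * ‖w‖ := by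
    rw [hmw, le_div_iff₀ hapos]
    nlinarith
  have hmain := half_mul_norm_le_norm_one_add_pow_sub_one w m hmw1
  rw [hqz, mul_pow, norm_sub_rev, ← mul_sub_one, norm_mul, norm_pow]
  calc 15 / 32 * (m * |p - q| * t) = 15 / 16 * (m * |p - q| * t / 2) := by ring
    _ ≤ ‖a‖ ^ m * ‖(1 + w) ^ m - 1‖ := by
      gcongr
      linarith

/-- lower bound on the ℓ1 distance between binomial distributions. -/
theorem stmt7 (m : ℕ) (hm : 1 ≤ m) (p q : ℝ) (hp0 : 0 < p) (hp1 : p < 1)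
    (hq0 : 0 ≤ q) (hq1 : q ≤ 1) :
    (1 / 350 : ℝ) * min ((m : ℝ) * |p - q|)
        (min (Real.sqrt m * |p - q| / Real.sqrt (p * (1 - p))) 1) ≤ binomL1 m p q := by
  have hm0 : (0 : ℝ) < m := by exact_mod_cast hm
  have hv : 0 < p * (1 - p) := mul_pos hp0 (by linarith)
  rcases eq_or_ne p q with rfl | hpq
  · simp [binomL1]
  have hd : 0 < |p - q| := abs_pos.mpr (sub_ne_zero.mpr hpq)
  set D := (m : ℝ) * |p - q| with hD
  set M := min D (min (√m * |p - q| / √(p * (1 - p))) 1) with hM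
  have hDpos : 0 < D := by positivity
  have hM0 : 0 ≤ M := by positivity
  have hMD : M ≤ D := min_le_left _ _
  have hMS : M ≤ √m * |p - q| / √(p * (1 - p)) := (min_le_right _ _).trans (min_le_left _ _)
  have hM1 : M ≤ 1 := (min_le_right _ _).trans (min_le_right _ _)
  have hDt : D * (M / (4 * D)) = M / 4 := by field_simp
  have hvar : m * (p * (1 - p)) * (M / (4 * D)) ^ 2 ≤ 1 / 16 := by
    have hsq : M ^ 2 ≤ m * |p - q| ^ 2 / (p * (1 - p)) := by
      refine (pow_le_pow_left₀ hM0 hMS 2).trans_eq ?_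
      rw [div_pow, mul_pow, Real.sq_sqrt hm0.le, Real.sq_sqrt hv.le]
    rw [le_div_iff₀ hv] at hsq
    rw [div_pow, ← mul_div_assoc, div_le_iff₀ (by positivity), hD]
    nlinarith
  have hmain := mul_le_binomL1 m (q := q) hp0 hp1 (t := M / (4 * D)) (by positivity)
    (by rw [div_le_iff₀ (by positivity)]; linarith) hvar (by rw [← hD, hDt]; linarith)
  rw [← hD, hDt] at hmain
  linarith
end

section
/- Let c > 0 be a constant, m a positive integer, and p, q ∈ [0,1]. If mp < c and p ≤ 1/2, then ℓ1(Bin(m,p), Bin(m,q)) ≥ (e^{−3c/2}/2) · min( m|p−q|, 1 ). -/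
theorem exp_neg_three_halves_le_one_sub {p : ℝ} (hp0 : 0 ≤ p) (hp : p ≤ 1 / 2) :
    Real.exp (-(3 * p / 2)) ≤ 1 - p := by
  have hquad := Real.quadratic_le_exp_of_nonneg (x := 3 * p / 2) (by positivity)
  have hbound : 1 ≤ (1 - p) * (1 + 3 * p / 2 + (3 * p / 2) ^ 2 / 2) := by
    have : 0 ≤ p * ((1 / 2 - p) * (1 + p)) := by
      have : 0 ≤ 1 / 2 - p := by linarith
      positivity
    nlinarith [mul_nonneg hp0 hp0]
  rw [Real.exp_neg, inv_le_iff_one_le_mul₀ (Real.exp_pos _)]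
  nlinarith

theorem exp_le_one_sub_pow {c p : ℝ} {m : ℕ} (hp0 : 0 ≤ p) (hp : p ≤ 1 / 2)
    (hmp : (m : ℝ) * p < c) : Real.exp (-(3 * c) / 2) ≤ (1 - p) ^ m :=
  calc Real.exp (-(3 * c) / 2) ≤ Real.exp (m * -(3 * p / 2)) :=
        Real.exp_le_exp.mpr (by linarith)
    _ = Real.exp (-(3 * p / 2)) ^ m := Real.exp_nat_mul _ _
    _ ≤ (1 - p) ^ m := by
        gcongr
        exact exp_neg_three_halves_le_one_sub hp0 hp

theorem one_sub_pow_mul_le {a b : ℝ} (m : ℕ) (ha : 0 ≤ a) (hab : a ≤ b) (hb : b ≤ 1) :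
    (1 - b) ^ m * (1 + m * (b - a)) ≤ (1 - a) ^ m :=
  calc (1 - b) ^ m * (1 + m * (b - a)) ≤ (1 - b) ^ m * (1 + (b - a)) ^ m := by
        have : 0 ≤ 1 - b := by linarith
        gcongr
        exact one_add_mul_le_pow (by linarith) m
    _ = ((1 - b) * (1 + (b - a))) ^ m := (mul_pow _ _ _).symm
    _ ≤ (1 - a) ^ m := by
        have : 0 ≤ 1 - b := by linarith
        have : 0 ≤ b - a := by linarith
        gcongr
        nlinarith

theorem abs_one_sub_pow_sub_le_binomL1 (m : ℕ) (p q : ℝ) :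
    |(1 - p) ^ m - (1 - q) ^ m| ≤ binomL1 m p q := by
  have h := Finset.single_le_sum (f := fun j => |binomPMF m p j - binomPMF m q j|)
    (fun j _ => abs_nonneg _) (Finset.mem_range.mpr m.succ_pos)
  simpa [binomL1, binomPMF] using h

theorem half_mul_min_le_abs_one_sub_pow_sub {p q : ℝ} (m : ℕ) (hp0 : 0 ≤ p) (hp1 : p ≤ 1)
    (hq0 : 0 ≤ q) (hq1 : q ≤ 1) :
    (1 - p) ^ m / 2 * min (m * |p - q|) 1 ≤ |(1 - p) ^ m - (1 - q) ^ m| := by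
  have hP : 0 ≤ (1 - p) ^ m := pow_nonneg (by linarith) m
  rcases le_total p q with h | h
  · have hle := one_sub_pow_mul_le m hp0 h hq1
    rw [abs_sub_comm p q, abs_of_nonneg (sub_nonneg.mpr h)]
    have hx : 0 ≤ m * (q - p) := mul_nonneg m.cast_nonneg (sub_nonneg.mpr h)
    generalize (m : ℝ) * (q - p) = x at hle hx ⊢
    have hmin : min x 1 * (1 + x) ≤ 2 * x := by
      rcases le_total x 1 with h1 | h1
      · rw [min_eq_left h1]; nlinarith
      · rw [min_eq_right h1]; linarith
    refine le_trans ?_ (le_abs_self _)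
    refine le_of_mul_le_mul_right ?_ (show 0 < 1 + x by linarith)
    nlinarith [mul_le_mul_of_nonneg_left hmin hP]
  · have hle := one_sub_pow_mul_le m hq0 h hp1
    rw [abs_of_nonneg (sub_nonneg.mpr h), abs_sub_comm]
    have hx : 0 ≤ m * (p - q) := mul_nonneg m.cast_nonneg (sub_nonneg.mpr h)
    generalize (m : ℝ) * (p - q) = x at hle hx ⊢
    refine le_trans ?_ (le_abs_self _)
    nlinarith [mul_le_mul_of_nonneg_left (min_le_left x 1) hP, mul_nonneg hP hx]

/-- lower bound on the ℓ1 distance between binomial distributions in the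
small-`mp` regime: if `mp < c` and `p ≤ 1/2`, then
`ℓ1(Bin(m,p), Bin(m,q)) ≥ (e^{-3c/2}/2) min(m|p-q|, 1)`. -/
theorem stmt8 (c : ℝ) (hc : 0 < c) (m : ℕ) (hm : 1 ≤ m) (p q : ℝ)
    (hp0 : 0 ≤ p) (hp1 : p ≤ 1) (hq0 : 0 ≤ q) (hq1 : q ≤ 1)
    (hmp : (m : ℝ) * p < c) (hphalf : p ≤ 1 / 2) :
    Real.exp (-(3 * c) / 2) / 2 * min ((m : ℝ) * |p - q|) 1 ≤ binomL1 m p q := by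
  have hmin : 0 ≤ min ((m : ℝ) * |p - q|) 1 := by positivity
  calc Real.exp (-(3 * c) / 2) / 2 * min ((m : ℝ) * |p - q|) 1
      ≤ (1 - p) ^ m / 2 * min ((m : ℝ) * |p - q|) 1 := by
        gcongr
        exact exp_le_one_sub_pow hp0 hphalf hmp
    _ ≤ |(1 - p) ^ m - (1 - q) ^ m| :=
        half_mul_min_le_abs_one_sub_pow_sub m hp0 hp1 hq0 hq1
    _ ≤ binomL1 m p q := abs_one_sub_pow_sub_le_binomL1 m p q
end

section
/- For all integers m ≥ 2, all integers k with 1 ≤ k ≤ m − 1, and all p ∈ (0,1), the binomial probability mass function satisfies Pr(Bin(m,p) = k) ≥ (√(2π)/e²) · (1/√k) · exp( −m (k/m − p)² / (p(1−p)) ). -/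
/-- Stirling-type upper bound on the factorial, valid for every positive integer. -/
theorem factorial_le_exp_mul_sqrt_mul_pow {n : ℕ} (hn : n ≠ 0) :
    (n.factorial : ℝ) ≤ Real.exp 1 * Real.sqrt n * (n / Real.exp 1) ^ n := by
  obtain ⟨j, rfl⟩ := Nat.exists_eq_succ_of_ne_zero hn
  have h : Stirling.stirlingSeq (j + 1) ≤ Stirling.stirlingSeq 1 :=
    Stirling.stirlingSeq'_antitone (Nat.zero_le j)
  rw [Stirling.stirlingSeq_one, Stirling.stirlingSeq, div_le_iff₀ (by positivity)] at h
  refine h.trans (le_of_eq ?_)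
  rw [Real.sqrt_mul (by norm_num)]
  field_simp

/-- The reciprocal form of `1 + x ≤ exp x`, raised to a power. -/
theorem exp_mul_one_sub_inv_le_pow {x : ℝ} (hx : 0 < x) (n : ℕ) :
    Real.exp (n * (1 - x⁻¹)) ≤ x ^ n := by
  rw [Real.exp_nat_mul]
  refine pow_le_pow_left₀ (Real.exp_pos _).le ?_ n
  rw [← Real.le_log_iff_exp_le hx]
  exact Real.one_sub_inv_le_log_of_pos hx

/-- Stirling lower bound on a binomial coefficient. -/
theorem sqrt_two_pi_mul_pow_le_choose_add {k n : ℕ} (hk : k ≠ 0) (hn : n ≠ 0) :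
    Real.sqrt (2 * Real.pi) / Real.exp 1 ^ 2 * (1 / Real.sqrt k) *
        ((((k + n : ℕ) : ℝ) / k) ^ k * (((k + n : ℕ) : ℝ) / n) ^ n) ≤
      ((k + n).choose k : ℝ) := by
  have hk0 : (0 : ℝ) < k := by positivity
  have hn0 : (0 : ℝ) < n := by positivity
  have hs : Real.sqrt n ≤ Real.sqrt ((k + n : ℕ) : ℝ) :=
    Real.sqrt_le_sqrt (by push_cast; linarith)
  rw [Nat.choose_symm_add, Nat.add_choose,
    Nat.cast_div (Nat.factorial_mul_factorial_dvd_factorial_add k n)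
    (by positivity), Nat.cast_mul, le_div_iff₀ (by positivity)]
  refine le_trans ?_ (Stirling.le_factorial_stirling (k + n))
  refine (mul_le_mul_of_nonneg_left (mul_le_mul (factorial_le_exp_mul_sqrt_mul_pow hk)
    (factorial_le_exp_mul_sqrt_mul_pow hn) (by positivity) (by positivity))
    (by positivity)).trans ?_
  rw [Real.sqrt_mul (by positivity) ((k + n : ℕ) : ℝ)]
  calc _ = Real.sqrt (2 * Real.pi) * Real.sqrt n *
        (((k + n : ℕ) : ℝ) / Real.exp 1) ^ (k + n) := by
        simp only [div_pow, pow_add]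
        field_simp
    _ ≤ _ := by gcongr

/-- lower bound on the binomial probability mass function: for `2 ≤ m`,
`1 ≤ k ≤ m - 1` and `p ∈ (0,1)`,
`Pr(Bin(m,p) = k) ≥ (√(2π)/e²) (1/√k) exp(-m (k/m - p)²/(p(1-p)))`. -/
theorem stmt12 (m k : ℕ) (hm : 2 ≤ m) (hk1 : 1 ≤ k) (hk2 : k ≤ m - 1) (p : ℝ)
    (hp0 : 0 < p) (hp1 : p < 1) :
    Real.sqrt (2 * Real.pi) / Real.exp 1 ^ 2 * (1 / Real.sqrt k) *
        Real.exp (-(m : ℝ) * ((k : ℝ) / m - p) ^ 2 / (p * (1 - p))) ≤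
      (m.choose k : ℝ) * p ^ k * (1 - p) ^ (m - k) := by
  obtain ⟨n, rfl⟩ := Nat.exists_eq_add_of_le (show k ≤ m by omega)
  have hk : k ≠ 0 := by omega
  have hn : n ≠ 0 := by omega
  have hk0 : (0 : ℝ) < k := by positivity
  have hn0 : (0 : ℝ) < n := by positivity
  have hq : 0 < 1 - p := by linarith
  rw [Nat.add_sub_cancel_left]
  have hexp : Real.exp (-((k + n : ℕ) : ℝ) * ((k : ℝ) / (k + n : ℕ) - p) ^ 2 / (p * (1 - p))) ≤
      (((k + n : ℕ) : ℝ) / k * p) ^ k * (((k + n : ℕ) : ℝ) / n * (1 - p)) ^ n := by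
    refine le_trans (le_of_eq ?_) (mul_le_mul
      (exp_mul_one_sub_inv_le_pow (by positivity) k)
      (exp_mul_one_sub_inv_le_pow (by positivity) n) (Real.exp_pos _).le (by positivity))
    rw [← Real.exp_add]
    congr 1
    push_cast
    field_simp
    ring
  refine (mul_le_mul_of_nonneg_left hexp (by positivity)).trans ?_
  calc _ = Real.sqrt (2 * Real.pi) / Real.exp 1 ^ 2 * (1 / Real.sqrt k) *
        ((((k + n : ℕ) : ℝ) / k) ^ k * (((k + n : ℕ) : ℝ) / n) ^ n) * p ^ k * (1 - p) ^ n := by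
        rw [mul_pow, mul_pow]
        ring
    _ ≤ _ := by
        gcongr
        exact sqrt_two_pi_mul_pow_le_choose_add hk hn
end
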